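/- arXiv:2401.13423 — 3 statements merged into one kernel-verified Lean document; each statement's English description precedes it below -/
import Mathlib

section
/- For the complete graph K_n and an integer k with 2 ≤ k ≤ n, the k-path connectivity of K_n equals ⌊(2n + k² - 3k)/(2(k-1))⌋. -/
open SimpleGraph

/-- A Steiner `S`-path in `G`: a path whose vertex set contains `S`. -/
structure SteinerPath {V : Type*} (G : SimpleGraph V) (S : Set V) where
  first : V
  last : V
  walk : G.Walk first last
  isPath : walk.IsPath
  contains : ∀ s ∈ S, s ∈ walk.support

/-- A family of internally disjoint `S`-paths: any two intersect exactly in `S`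
and share no edges. -/
def IDFamily {V : Type*} (G : SimpleGraph V) (S : Set V) {t : ℕ}
    (P : Fin t → SteinerPath G S) : Prop :=
  ∀ i j, i ≠ j →
    ({v | v ∈ (P i).walk.support} ∩ {v | v ∈ (P j).walk.support} = S) ∧
    (∀ e ∈ (P i).walk.edges, e ∉ (P j).walk.edges)

/-- The maximum number of internally disjoint `S`-paths in `G`. -/
noncomputable def steinerPathNumber {V : Type*} (G : SimpleGraph V) (S : Set V) : ℕ :=
  sSup {t | ∃ P : Fin t → SteinerPath G S, IDFamily G S P}

/-- The `r`-path connectivity of `G`. -/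
noncomputable def pathConnectivity {V : Type*} (G : SimpleGraph V) (r : ℕ) : ℕ :=
  sInf {m | ∃ S : Finset V, S.card = r ∧ steinerPathNumber G (↑S) = m}

section UpperBound

variable {V : Type*} [DecidableEq V] {G : SimpleGraph V}

/-- Between two consecutive visits to `S`, a walk uses an edge inside `S` or a vertex outside. -/
theorem SimpleGraph.Walk.countP_support_le (S : Finset V) {u v : V} (p : G.Walk u v) :
    p.support.countP (· ∈ S) ≤ (if u ∈ S then 1 else 0) +
      p.edges.countP (· ∈ S.sym2) + p.support.countP (· ∉ S) := by
  induction p with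
  | nil => simp [List.countP_cons]
  | @cons u v w h p ih =>
    rw [Walk.support_cons, Walk.edges_cons]
    simp only [List.countP_cons, Finset.mk_mem_sym2_iff, decide_eq_true_eq]
    by_cases hu : u ∈ S <;> by_cases hv : v ∈ S <;> simp [hu, hv] at ih ⊢ <;> omega

theorem SteinerPath.card_le {S : Finset V} (P : SteinerPath G (S : Set V)) :
    S.card ≤ 1 + (P.walk.edges.toFinset.filter (· ∈ S.sym2)).card +
      (P.walk.support.toFinset.filter (· ∉ S)).card := by
  have h := P.walk.countP_support_le S
  have h₁ : S.card ≤ P.walk.support.countP (· ∈ S) := by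
    rw [List.countP_eq_length_filter,
      ← List.toFinset_card_of_nodup (P.isPath.support_nodup.filter _)]
    refine Finset.card_le_card fun s hs => ?_
    simpa using ⟨P.contains s hs, hs⟩
  have h₂ : (P.walk.edges.toFinset.filter (· ∈ S.sym2)).card =
      P.walk.edges.countP (· ∈ S.sym2) := by
    rw [List.countP_eq_length_filter, ← List.toFinset_card_of_nodup
      (P.isPath.isTrail.edges_nodup.filter _), List.toFinset_filter]
    exact congrArg _ (Finset.filter_congr fun e _ => by rw [decide_eq_true_eq])
  have h₃ : (P.walk.support.toFinset.filter (· ∉ S)).card =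
      P.walk.support.countP (· ∉ S) := by
    rw [List.countP_eq_length_filter, ← List.toFinset_card_of_nodup
      (P.isPath.support_nodup.filter _), List.toFinset_filter]
    simp
  split_ifs at h <;> omega

theorem IDFamily.mul_le [Fintype V] {S : Finset V} {t : ℕ}
    {P : Fin t → SteinerPath G (S : Set V)} (hP : IDFamily G (S : Set V) P) :
    t * (S.card - 1) ≤ S.card.choose 2 + (Fintype.card V - S.card) := by
  have hE : ∑ i, ((P i).walk.edges.toFinset.filter (· ∈ S.sym2)).card ≤
      S.card.choose 2 := by
    rw [← Finset.card_biUnion, ← Sym2.card_image_offDiag]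
    · refine Finset.card_le_card fun e he => ?_
      simp only [Finset.mem_biUnion, Finset.mem_univ, true_and, Finset.mem_filter,
        List.mem_toFinset] at he
      obtain ⟨i, he, hS⟩ := he
      induction e with
      | _ a b =>
        have hab : a ≠ b := ((P i).walk.adj_of_mem_edges he).ne
        have ⟨ha, hb⟩ := Finset.mk_mem_sym2_iff.1 hS
        exact Finset.mem_image.2 ⟨(a, b), by simpa using ⟨ha, hb, hab⟩, rfl⟩
    · intro i _ j _ hij
      rw [Function.onFun, Finset.disjoint_left]
      intro e he he'
      simp only [Finset.mem_filter, List.mem_toFinset] at he he'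
      exact (hP i j hij).2 e he.1 he'.1
  have hO : ∑ i, ((P i).walk.support.toFinset.filter (· ∉ S)).card ≤
      Fintype.card V - S.card := by
    rw [← Finset.card_biUnion, ← Finset.card_compl]
    · refine Finset.card_le_card fun v hv => ?_
      simp only [Finset.mem_biUnion, Finset.mem_filter] at hv
      obtain ⟨i, -, -, hv⟩ := hv
      simpa using hv
    · intro i _ j _ hij
      rw [Function.onFun, Finset.disjoint_left]
      intro v hv hv'
      simp only [Finset.mem_filter, List.mem_toFinset] at hv hv'
      have : v ∈ (S : Set V) := (hP i j hij).1 ▸ ⟨hv.1, hv'.1⟩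
      exact hv.2 (by simpa using this)
  calc t * (S.card - 1) = ∑ _i : Fin t, (S.card - 1) := by simp
    _ ≤ ∑ i, (((P i).walk.edges.toFinset.filter (· ∈ S.sym2)).card +
          ((P i).walk.support.toFinset.filter (· ∉ S)).card) :=
        Finset.sum_le_sum fun i _ => by have := (P i).card_le; omega
    _ ≤ _ := by rw [Finset.sum_add_distrib]; exact Nat.add_le_add hE hO

end UpperBound

section Construction

variable {V : Type*}

/-- The path `z 0, z 1, …, z l` of a complete graph, detouring through `w j` after `z j`
whenever `D j` holds. -/
theorem exists_isPath_with_detours (z w : ℕ → V) (D : ℕ → Prop) (l : ℕ)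
    (hz : Set.InjOn z (Set.Iic l)) (hw : Set.InjOn w {j | j < l ∧ D j})
    (hzw : ∀ i ≤ l, ∀ j < l, D j → z i ≠ w j) :
    ∃ p : (⊤ : SimpleGraph V).Walk (z 0) (z l), p.IsPath ∧
      (∀ v, v ∈ p.support ↔ (∃ j ≤ l, v = z j) ∨ ∃ j < l, D j ∧ v = w j) ∧
      ∀ e ∈ p.edges, (∃ j < l, ¬ D j ∧ e = s(z j, z (j + 1))) ∨ ∃ j < l, D j ∧ w j ∈ e := by
  induction l with
  | zero => exact ⟨.nil, by simp, by simp, by simp⟩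
  | succ l ih =>
    obtain ⟨p, hp, hs, he⟩ := ih (hz.mono (by simp))
      (hw.mono (Set.ofPred_subset_ofPred.2 fun j hj => ⟨hj.1.trans (Nat.lt_succ_self l), hj.2⟩))
      (fun i hi j hj => hzw i (by omega) j (by omega))
    have hzl : z (l + 1) ∉ p.support := by
      rw [hs]
      rintro (⟨j, hj, h⟩ | ⟨j, hj, hD, h⟩)
      · have := hz (by simp) (by simp; omega) h
        omega
      · exact hzw _ le_rfl j (by omega) hD h
    by_cases hD : D l
    · have hwl : w l ∉ p.support := by
        rw [hs]
        rintro (⟨j, hj, h⟩ | ⟨j, hj, hD', h⟩)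
        · exact hzw j (by omega) l (by omega) hD h.symm
        · have := hw ⟨by omega, hD⟩ ⟨by omega, hD'⟩ h
          omega
      have h₁ : (⊤ : SimpleGraph V).Adj (z l) (w l) := hzw l (by omega) l (by omega) hD
      have h₂ : (⊤ : SimpleGraph V).Adj (w l) (z (l + 1)) :=
        (hzw (l + 1) le_rfl l (by omega) hD).symm
      refine ⟨(p.concat h₁).concat h₂, (hp.concat hwl h₁).concat ?_ h₂, fun v => ?_, ?_⟩
      · simpa [Walk.support_concat, hzl] using h₂.ne'
      · simp only [Walk.support_concat, List.mem_append,
          List.mem_singleton, hs, Nat.le_succ_iff_eq_or_le, Nat.lt_succ_iff_lt_or_eq]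
        grind
      · intro e h
        simp only [Walk.edges_concat, List.concat_eq_append, List.mem_append,
          List.mem_singleton] at h
        rcases h with (h | rfl) | rfl
        · rcases he e h with ⟨j, hj, h⟩ | ⟨j, hj, h⟩
          · exact .inl ⟨j, by omega, h⟩
          · exact .inr ⟨j, by omega, h⟩
        · exact .inr ⟨l, by omega, hD, by simp⟩
        · exact .inr ⟨l, by omega, hD, by simp⟩
    · have h₁ : (⊤ : SimpleGraph V).Adj (z l) (z (l + 1)) := fun h => by
        have := hz (by simp) (by simp) h
        omega
      refine ⟨p.concat h₁, hp.concat hzl h₁, fun v => ?_, ?_⟩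
      · simp only [Walk.support_concat, List.mem_append,
          List.mem_singleton, hs, Nat.le_succ_iff_eq_or_le, Nat.lt_succ_iff_lt_or_eq]
        grind
      · intro e h
        simp only [Walk.edges_concat, List.concat_eq_append, List.mem_append,
          List.mem_singleton] at h
        rcases h with h | rfl
        · rcases he e h with ⟨j, hj, h⟩ | ⟨j, hj, h⟩
          · exact .inl ⟨j, by omega, h⟩
          · exact .inr ⟨j, by omega, h⟩
        · exact .inl ⟨l, by omega, hD, rfl⟩

/-- The offsets `0, 1, -1, 2, -2, …` of the Walecki zigzag. -/
def zigzag (j : ℕ) : ℤ := if j % 2 = 0 then -(j / 2 : ℕ) else (j / 2 : ℕ) + 1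

theorem zigzag_add_zigzag_succ (j : ℕ) : zigzag j + zigzag (j + 1) = 1 - (j % 2 : ℕ) := by
  unfold zigzag
  split_ifs <;> omega

theorem injOn_add_zigzag (k : ℕ) (c : ZMod k) :
    Set.InjOn (fun j => c + (zigzag j : ZMod k)) (Set.Iio k) := by
  intro a ha b hb h
  simp only [Set.mem_Iio] at ha hb
  have h := (ZMod.intCast_eq_intCast_iff_dvd_sub _ _ _).1 (add_left_cancel h)
  have h0 := Int.eq_zero_of_abs_lt_dvd h (by unfold zigzag; rw [abs_lt]; split_ifs <;> omega)
  unfold zigzag at h0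
  split_ifs at h0 <;> omega

theorem exists_add_zigzag_eq (k : ℕ) [NeZero k] (c x : ZMod k) :
    ∃ j < k, c + (zigzag j : ZMod k) = x := by
  have hinj : Function.Injective fun j : Fin k => c + (zigzag j : ZMod k) :=
    fun a b h => Fin.ext (injOn_add_zigzag k c a.2 b.2 h)
  obtain ⟨j, hj⟩ := ((Fintype.bijective_iff_injective_and_card _).2 ⟨hinj, by simp⟩).2 x
  exact ⟨j, j.2, hj⟩

/-- An injective numbering of the gaps whose label `2 * i + 1 - j % 2` is at least `k`. -/
theorem exists_gap_numbering (k m t : ℕ) (hk : 2 ≤ k)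
    (ht : 2 * (t * (k - 1)) ≤ k * (k - 1) + 2 * m) :
    ∃ f : ℕ → ℕ → ℕ,
      (∀ i < t, ∀ j < k - 1, k ≤ 2 * i + 1 - j % 2 → f i j < m) ∧
      ∀ i j i' j', j < k - 1 → j' < k - 1 → k ≤ 2 * i + 1 - j % 2 → k ≤ 2 * i' + 1 - j' % 2 →
        f i j = f i' j' → i = i' ∧ j = j' := by
  have key : ∀ q a b a' b' : ℕ, b < q → b' < q → q * a + b = q * a' + b' → a = a' ∧ b = b' := by
    intro q a b a' b' hb hb' h
    have ha : a = a' := by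
      have := congrArg (· / q) h
      simpa [Nat.mul_add_div (by omega : 0 < q), Nat.div_eq_of_lt hb,
        Nat.div_eq_of_lt hb'] using this
    subst ha
    exact ⟨rfl, by omega⟩
  obtain ⟨r, rfl | rfl⟩ := Nat.even_or_odd' k
  · refine ⟨fun i j => (2 * r - 1) * (i - r) + j, fun i hi j hj h => ?_, ?_⟩
    · obtain ⟨d, rfl⟩ : ∃ d, i = r + d := ⟨i - r, by omega⟩
      obtain ⟨q, hq⟩ : ∃ q, 2 * r = q + 1 := ⟨2 * r - 1, by omega⟩
      simp only [hq, Nat.add_sub_cancel] at ht hj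
      simp only [hq, Nat.add_sub_cancel, Nat.add_sub_cancel_left]
      have : (r + d + 1) * q ≤ t * q := Nat.mul_le_mul_right _ hi
      nlinarith
    · intro i j i' j' hj hj' h h' hf
      have := key _ _ _ _ _ hj hj' hf
      omega
  · simp only [Nat.add_sub_cancel] at *
    refine ⟨fun i j => if i = r then j / 2 else r + (2 * r * (i - r - 1) + j),
      fun i hi j hj h => ?_, ?_⟩
    · dsimp only
      split_ifs with hir
      · subst hir
        have : (i + 1) * (2 * i) ≤ t * (2 * i) := Nat.mul_le_mul_right _ hi
        have : i ≤ m := by nlinarith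
        omega
      · obtain ⟨d, rfl⟩ : ∃ d, i = r + d + 1 := ⟨i - r - 1, by omega⟩
        have h1 : (r + d + 1 + 1) * (2 * r) ≤ t * (2 * r) := Nat.mul_le_mul_right _ hi
        have h2 : r + d + 1 - r - 1 = d := by omega
        rw [h2]
        nlinarith
    · intro i j i' j' hj hj' h h' hf
      dsimp only at hf
      split_ifs at hf with h1 h2 h2
      · omega
      · exfalso; omega
      · exfalso; omega
      · have := key _ _ _ _ _ hj hj' (Nat.add_left_cancel hf)
        omega

theorem exists_idFamily_top [Fintype V] (S : Finset V) (t : ℕ) (hS : 2 ≤ S.card)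
    (ht : 2 * (t * (S.card - 1)) ≤
      S.card * (S.card - 1) + 2 * (Fintype.card V - S.card)) :
    ∃ P : Fin t → SteinerPath (⊤ : SimpleGraph V) (S : Set V),
      IDFamily (⊤ : SimpleGraph V) (S : Set V) P := by
  classical
  obtain ⟨k, hk⟩ : ∃ k, S.card = k := ⟨_, rfl⟩
  obtain ⟨m, hm⟩ : ∃ m, Fintype.card V - S.card = m := ⟨_, rfl⟩
  rw [hm, hk] at ht
  rw [hk] at hS
  have : NeZero k := ⟨by omega⟩
  obtain ⟨f, hfm, hf⟩ := exists_gap_numbering k m t hS ht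
  let φ : ZMod k ≃ S := Fintype.equivOfCardEq (by simp [ZMod.card, hk])
  let ψ : Fin m ≃ (Sᶜ : Finset V) :=
    Fintype.equivOfCardEq (by simp [hm])
  let z : ℕ → ℕ → V := fun i j => φ ((i : ZMod k) + (zigzag j : ZMod k))
  have hVne : Nonempty V := ⟨φ 0⟩
  let w : ℕ → ℕ → V := fun i j =>
    if h : f i j < m then ψ ⟨f i j, h⟩ else hVne.some
  let D : ℕ → ℕ → Prop := fun i j => k ≤ 2 * i + 1 - j % 2
  have hzS : ∀ i j, z i j ∈ S := fun i j => (φ _).2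
  have hwS : ∀ i < t, ∀ j < k - 1, D i j → w i j ∉ S := by
    intro i hi j hj h
    have := Finset.mem_compl.1 (ψ ⟨f i j, hfm i hi j hj h⟩).2
    simpa only [w, hfm i hi j hj h, dif_pos] using this
  have hw : ∀ i < t, ∀ i' < t, ∀ j < k - 1, ∀ j' < k - 1, D i j → D i' j' →
      w i j = w i' j' → i = i' ∧ j = j' := by
    intro i hi i' hi' j hj j' hj' h h' heq
    simp only [w, hfm i hi j hj h, hfm i' hi' j' hj' h', dif_pos] at heq
    have := ψ.injective (Subtype.ext heq)
    exact hf i j i' j' hj hj' h h' (by simpa using this)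
  have hpath : ∀ i : Fin t, _ := fun i =>
    exists_isPath_with_detours (z i) (w i) (D i) (k - 1)
      (fun a ha b hb h => injOn_add_zigzag k (i : ℕ)
        (by simp at ha ⊢; omega) (by simp at hb ⊢; omega) (φ.injective (Subtype.ext h)))
      (fun a ha b hb h => (hw i i.2 i i.2 a ha.1 b hb.1 ha.2 hb.2 h).2)
      (fun a _ b hb hD h => hwS i i.2 b hb hD (h ▸ hzS i a))
  choose p hp hs he using hpath
  have hcontains : ∀ i, ∀ s ∈ (S : Set V), s ∈ (p i).support := by
    intro i s hsS
    obtain ⟨j, hj, h⟩ := exists_add_zigzag_eq k (i : ℕ) (φ.symm ⟨s, hsS⟩)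
    exact (hs i s).2 (.inl ⟨j, by omega, by simp [z, h]⟩)
  have hinter : ∀ i j, i ≠ j → ∀ v, v ∈ (p i).support → v ∈ (p j).support → v ∈ S := by
    intro i j hij v hi hj
    rcases (hs i v).1 hi with ⟨a, _, rfl⟩ | ⟨a, ha, hDa, rfl⟩
    · exact hzS _ _
    · rcases (hs j _).1 hj with ⟨b, _, h⟩ | ⟨b, hb, hDb, h⟩
      · exact h ▸ hzS _ _
      · exact absurd (Fin.ext (hw i i.2 j j.2 a ha b hb hDa hDb h).1) hij
  refine ⟨fun i => ⟨_, _, p i, hp i, hcontains i⟩, fun i j hij => ⟨?_, fun e hei hej => ?_⟩⟩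
  · ext v
    exact ⟨fun h => hinter i j hij v h.1 h.2, fun h => ⟨hcontains i v h, hcontains j v h⟩⟩
  · dsimp only at hei hej
    rcases he i e hei with ⟨a, ha, hDa, rfl⟩ | ⟨a, ha, hDa, hmem⟩
    · rcases he j _ hej with ⟨b, hb, hDb, heq⟩ | ⟨b, hb, hDb, hmem⟩
      · have hsum : ∀ (i a : ℕ), ((i : ZMod k) + (zigzag a : ZMod k)) +
            ((i : ZMod k) + (zigzag (a + 1) : ZMod k)) = ((2 * i + 1 - a % 2 : ℕ) : ZMod k) := by
          intro i a
          have h : ((2 * i + 1 - a % 2 : ℕ) : ℤ) = i + zigzag a + (i + zigzag (a + 1)) := by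
            have := zigzag_add_zigzag_succ a
            omega
          have := congrArg (Int.cast : ℤ → ZMod k) h
          push_cast at this
          exact_mod_cast this.symm
        have hlab : ((2 * (i : ℕ) + 1 - a % 2 : ℕ) : ZMod k) =
            ((2 * (j : ℕ) + 1 - b % 2 : ℕ) : ZMod k) := by
          rw [← hsum, ← hsum]
          rcases Sym2.eq_iff.1 heq with ⟨h₁, h₂⟩ | ⟨h₁, h₂⟩
          · rw [φ.injective (Subtype.ext h₁), φ.injective (Subtype.ext h₂)]
          · rw [φ.injective (Subtype.ext h₁), φ.injective (Subtype.ext h₂), add_comm]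
        have := (ZMod.natCast_eq_natCast_iff' _ _ _).1 hlab
        rw [Nat.mod_eq_of_lt (not_le.1 hDa), Nat.mod_eq_of_lt (not_le.1 hDb)] at this
        exact hij (Fin.ext (by omega))
      · exact hwS j j.2 b hb hDb (hinter i j hij _
          ((p i).mem_support_of_mem_edges hei hmem) ((p j).mem_support_of_mem_edges hej hmem))
    · exact hwS i i.2 a ha hDa (hinter i j hij _
        ((p i).mem_support_of_mem_edges hei hmem) ((p j).mem_support_of_mem_edges hej hmem))

theorem steinerPathNumber_top [Fintype V] (S : Finset V) (hS : 2 ≤ S.card) :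
    steinerPathNumber (⊤ : SimpleGraph V) (S : Set V) =
      (S.card * (S.card - 1) + 2 * (Fintype.card V - S.card)) / (2 * (S.card - 1)) := by
  classical
  refine IsGreatest.csSup_eq ⟨exists_idFamily_top S _ hS ?_, ?_⟩
  · rw [Nat.mul_left_comm]
    exact Nat.div_mul_le_self _ _
  · rintro t ⟨P, hP⟩
    rw [Nat.le_div_iff_mul_le (by omega), Nat.mul_left_comm]
    have h := hP.mul_le
    have h₂ := Nat.div_mul_le_self (S.card * (S.card - 1)) 2
    rw [Nat.choose_two_right] at h
    omega

end Construction

/-- The `k`-path connectivity of the complete graph `K_n` for `2 ≤ k ≤ n`. -/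
theorem stmt1 (n k : ℕ) (hk : 2 ≤ k) (hkn : k ≤ n) :
    pathConnectivity (⊤ : SimpleGraph (Fin n)) k = (2 * n + k ^ 2 - 3 * k) / (2 * (k - 1)) := by
  have hnum : 2 * n + k ^ 2 - 3 * k = k * (k - 1) + 2 * (n - k) := by
    obtain ⟨a, rfl⟩ : ∃ a, k = a + 2 := ⟨k - 2, by omega⟩
    obtain ⟨b, rfl⟩ : ∃ b, n = a + 2 + b := ⟨n - (a + 2), by omega⟩
    simp only [Nat.add_sub_cancel_left, show a + 2 - 1 = a + 1 by omega]
    rw [Nat.sub_eq_iff_eq_add (by nlinarith)]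
    ring
  have hval : ∀ S : Finset (Fin n), S.card = k →
      steinerPathNumber (⊤ : SimpleGraph (Fin n)) (S : Set (Fin n)) =
        (2 * n + k ^ 2 - 3 * k) / (2 * (k - 1)) := by
    rintro S rfl
    rw [steinerPathNumber_top S hk, hnum, Fintype.card_fin]
  obtain ⟨S, -, hS⟩ := Finset.exists_subset_card_eq
    (show k ≤ (Finset.univ : Finset (Fin n)).card by simpa using hkn)
  refine IsLeast.csInf_eq ⟨⟨S, hS, hval S hS⟩, ?_⟩
  rintro m ⟨T, hT, rfl⟩
  exact (hval T hT).ge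
end

section
/- Let G be a k-regular connected graph with π₃(G) ≥ 2, and let x, y, z be three distinct vertices with |N(x) ∩ N(y) ∩ N(z)| = r. If 3k - 4π₃(G) ≥ r + 1, then there exist a vertex u and a set 𝒯 of π₃(G) internally disjoint {x,y,z}-paths such that u ∈ (N(x) ∪ N(y) ∪ N(z)) \ V(𝒯). -/
open SimpleGraph

namespace SteinerLinks

variable {V : Type*} {G : SimpleGraph V}

/-- `I` is the set of interior vertices of some path of `G` from `a` to `b`. -/
def Link (G : SimpleGraph V) (a b : V) (I : Finset V) : Prop :=
  ∃ l : List V, (a :: (l ++ [b])).IsChain G.Adj ∧ l.Nodup ∧ ∀ v, v ∈ l ↔ v ∈ I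

lemma Link.symm {a b : V} {I : Finset V} (h : Link G a b I) : Link G b a I := by
  obtain ⟨l, hc, hn, hm⟩ := h
  refine ⟨l.reverse, ?_, List.nodup_reverse.2 hn, by simpa using hm⟩
  have h' : (a :: (l ++ [b])).reverse.IsChain G.Adj :=
    List.isChain_reverse.2 (hc.imp fun _ _ h => h.symm)
  simpa using h'

lemma link_empty {a b : V} : Link G a b ∅ ↔ G.Adj a b := by
  constructor
  · rintro ⟨l, hc, -, hm⟩
    obtain rfl : l = [] := List.eq_nil_iff_forall_not_mem.2 (by simpa using hm)
    simpa using hc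
  · exact fun h => ⟨[], by simpa using h, List.nodup_nil, by simp⟩

lemma Link.adj_of_singleton {a b w : V} (h : Link G a b {w}) : G.Adj a w ∧ G.Adj w b := by
  obtain ⟨l, hc, hn, hm⟩ := h
  obtain rfl : l = [w] := by
    match l, hn, hm with
    | [], _, hm => simpa using hm w
    | [u], _, hm => simpa using (hm u).1 (by simp)
    | u :: v :: l, hn, hm =>
      have h1 := (hm u).1 (by simp)
      have h2 := (hm v).1 (by simp)
      simp only [Finset.mem_singleton] at h1 h2
      simp [h1, h2] at hn
  simpa using hc

/-- Rerouting a link at an interior vertex, towards a neighbour of that vertex. -/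
lemma Link.split {a b w : V} {I : Finset V} (h : Link G a b I) (hw : w ∈ I) :
    ∃ J₁ ⊆ I, ∃ J₂ ⊆ I, w ∈ J₁ ∧ w ∈ J₂ ∧ J₁.card + J₂.card = I.card + 1 ∧
      ∀ z, G.Adj w z → Link G a z J₁ ∧ Link G b z J₂ := by
  classical
  obtain ⟨l, hc, hn, hm⟩ := h
  obtain ⟨l₁, l₂, rfl⟩ := List.append_of_mem ((hm w).2 hw)
  have hI : I.card = (l₁ ++ w :: l₂).length := by
    rw [← List.toFinset_card_of_nodup hn]
    congr 1
    ext v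
    rw [List.mem_toFinset, hm]
  have hn₁ : (l₁ ++ [w]).Nodup := by grind
  have hn₂ : (w :: l₂).Nodup := by grind
  refine ⟨(l₁ ++ [w]).toFinset, fun v hv => (hm v).1 (by simp at hv ⊢; tauto),
    (w :: l₂).toFinset, fun v hv => (hm v).1 (by simp at hv ⊢; tauto), by simp, by simp, ?_, ?_⟩
  · rw [List.toFinset_card_of_nodup hn₁, List.toFinset_card_of_nodup hn₂, hI]
    simp only [List.length_append, List.length_cons, List.length_nil]
    omega
  · intro z hz
    have hc' : ((a :: l₁) ++ w :: (l₂ ++ [b])).IsChain G.Adj := by simpa using hc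
    obtain ⟨h₁, h₂⟩ := List.isChain_split.1 hc'
    constructor
    · refine ⟨l₁ ++ [w], ?_, hn₁, fun v => List.mem_toFinset.symm⟩
      have : ((a :: l₁) ++ w :: z :: []).IsChain G.Adj :=
        List.isChain_append_cons_cons.2 ⟨h₁, hz, by simp⟩
      simpa using this
    · refine Link.symm ⟨w :: l₂, ?_, hn₂, by simp⟩
      exact List.isChain_cons_cons.2 ⟨hz.symm, h₂⟩

/-- A link that cannot be shortened has at most one neighbour of each end. -/
lemma Link.neighbor_unique {a b w w' : V} {I : Finset V} (h : Link G a b I)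
    (hmin : ∀ J ⊆ I, J.Nonempty → Link G a b J → I.card ≤ J.card)
    (hw : w ∈ I) (hw' : w' ∈ I) (ha : G.Adj a w) (ha' : G.Adj a w') : w = w' := by
  classical
  obtain ⟨l, hc, hn, hm⟩ := h
  have hI : I = l.toFinset := by
    ext v
    rw [List.mem_toFinset, hm]
  have key : ∀ u ∈ l, G.Adj a u → ∃ t, l = u :: t := by
    intro u hu hau
    obtain ⟨l₁, l₂, rfl⟩ := List.append_of_mem hu
    have hc' : ((a :: l₁) ++ u :: (l₂ ++ [b])).IsChain G.Adj := by simpa using hc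
    have hn₂ : (u :: l₂).Nodup := by grind
    have := hmin (u :: l₂).toFinset (fun v hv => (hm v).1 (by simp at hv ⊢; tauto)) ⟨u, by simp⟩
      ⟨u :: l₂, List.isChain_cons_cons.2 ⟨hau, (List.isChain_split.1 hc').2⟩, hn₂, by simp⟩
    rw [hI, List.toFinset_card_of_nodup hn, List.toFinset_card_of_nodup hn₂] at this
    simp only [List.length_append, List.length_cons] at this
    obtain rfl : l₁ = [] := List.length_eq_zero_iff.1 (by omega)
    exact ⟨l₂, rfl⟩
  obtain ⟨t, ht⟩ := key w ((hm w).2 hw) ha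
  obtain ⟨t', ht'⟩ := key w' ((hm w').2 hw') ha'
  rw [ht] at ht'
  exact (List.cons.inj ht').1

lemma Link.exists_walk {a b : V} {I : Finset V} (h : Link G a b I) (hab : a ≠ b)
    (ha : a ∉ I) (hb : b ∉ I) :
    ∃ W : G.Walk a b, W.IsPath ∧ (∀ v, v ∈ W.support ↔ v = a ∨ v = b ∨ v ∈ I) ∧
      ∀ e ∈ W.edges, (∃ v ∈ e, v ∈ I) ∨ (I = ∅ ∧ e = s(a, b)) := by
  obtain ⟨l, hc, hn, hm⟩ := h
  obtain ⟨W, hsup⟩ : ∃ W : G.Walk a b, W.support = a :: (l ++ [b]) :=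
    ⟨(SimpleGraph.Walk.ofSupport _ (List.cons_ne_nil _ _) hc).copy (by simp) (by simp),
      (SimpleGraph.Walk.support_copy _ _ _).trans (SimpleGraph.Walk.support_ofSupport _ _)⟩
  have hp : W.IsPath := by
    rw [SimpleGraph.Walk.isPath_def, hsup]
    have h1 := hm a
    have h2 := hm b
    grind
  have hs : ∀ v, v ∈ W.support ↔ v = a ∨ v = b ∨ v ∈ I := by
    intro v
    rw [hsup, ← hm]
    simp only [List.mem_cons, List.mem_append, List.not_mem_nil, or_false]
    tauto
  refine ⟨W, hp, hs, fun e he => ?_⟩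
  by_contra! hcon
  obtain ⟨h1, h2⟩ := hcon
  have hee : e = s(a, b) := by
    induction e with | h u v =>
    have hu := (hs u).1 (W.fst_mem_support_of_mem_edges he)
    have hv := (hs v).1 (W.snd_mem_support_of_mem_edges he)
    have huv := (W.adj_of_mem_edges he).ne
    have := h1 u (by simp)
    have := h1 v (by simp)
    rw [Sym2.eq_iff]
    grind
  refine h2 ?_ hee
  subst hee
  have hl : l = [] := by
    cases W with
    | nil => exact absurd rfl hab
    | @cons _ c _ hac W' =>
      rw [SimpleGraph.Walk.cons_isPath_iff] at hp
      rw [SimpleGraph.Walk.edges_cons, List.mem_cons] at he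
      rcases he with he | he
      · obtain rfl : b = c := by
          rw [Sym2.eq_iff] at he
          grind
        rw [SimpleGraph.Walk.eq_nil_iff_nil.2 (SimpleGraph.Walk.isPath_iff_nil.1 hp.1)] at hsup
        simp only [SimpleGraph.Walk.support_cons, SimpleGraph.Walk.support_nil] at hsup
        have := congrArg List.length hsup
        simp only [List.length_cons, List.length_append, List.length_nil] at this
        exact List.length_eq_zero_iff.1 (by omega)
      · exact absurd (W'.fst_mem_support_of_mem_edges he) hp.2
  subst hl
  exact Finset.eq_empty_of_forall_notMem fun v hv => by simpa using (hm v).2 hv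

/-- `I` is the interior of a path joining the two terminals other than `p s`. -/
def TLink (G : SimpleGraph V) (p : Fin 3 → V) (s : Fin 3) (I : Finset V) : Prop :=
  ∀ a b, a ≠ b → a ≠ s → b ≠ s → Link G (p a) (p b) I

lemma tLink_of_link {p : Fin 3 → V} {a b s : Fin 3} {I : Finset V} (hab : a ≠ b) (ha : a ≠ s)
    (hb : b ≠ s) (h : Link G (p a) (p b) I) : TLink G p s I := by
  intro a' b' hab' ha' hb'
  obtain ⟨rfl, rfl⟩ | ⟨rfl, rfl⟩ : (a' = a ∧ b' = b) ∨ (a' = b ∧ b' = a) := by omega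
  · exact h
  · exact h.symm

lemma exists_steinerPath {p : Fin 3 → V} (hp : Function.Injective p) {s t : Fin 3} (hst : s ≠ t)
    {J K : Finset V} (hJ : TLink G p s J) (hK : TLink G p t K) (hpJ : ∀ a, p a ∉ J)
    (hpK : ∀ a, p a ∉ K) (hd : Disjoint J K) :
    ∃ P : SteinerPath G (Set.range p),
      (∀ v, v ∈ P.walk.support ↔ v ∈ Set.range p ∨ v ∈ J ∨ v ∈ K) ∧
      ∀ e ∈ P.walk.edges, (∃ v ∈ e, v ∈ J ∨ v ∈ K) ∨
        ∃ a b, a ≠ b ∧ e = s(p a, p b) ∧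
          ((J = ∅ ∧ a ≠ s ∧ b ≠ s) ∨ (K = ∅ ∧ a ≠ t ∧ b ≠ t)) := by
  obtain ⟨m, hms, hmt⟩ : ∃ m : Fin 3, m ≠ s ∧ m ≠ t :=
    (by decide : ∀ s t : Fin 3, ∃ m, m ≠ s ∧ m ≠ t) s t
  obtain ⟨W₁, hp₁, hs₁, he₁⟩ := (hJ t m hmt.symm hst.symm hms).exists_walk (hp.ne hmt.symm)
    (hpJ _) (hpJ _)
  obtain ⟨W₂, hp₂, hs₂, he₂⟩ := (hK m s hms hmt hst).exists_walk (hp.ne hms) (hpK _) (hpK _)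
  have hall : ∀ a : Fin 3, a = t ∨ a = m ∨ a = s := by omega
  have hs : ∀ v, v ∈ (W₁.append W₂).support ↔ v ∈ Set.range p ∨ v ∈ J ∨ v ∈ K := by
    intro v
    rw [SimpleGraph.Walk.mem_support_append_iff, hs₁, hs₂]
    constructor
    · rintro ((rfl | rfl | h) | (rfl | rfl | h)) <;> simp [*]
    · rintro (⟨a, rfl⟩ | h | h)
      · rcases hall a with rfl | rfl | rfl <;> simp
      · simp [h]
      · simp [h]
  refine ⟨⟨_, _, W₁.append W₂, ?_, fun v hv => (hs v).2 (Or.inl hv)⟩, hs, ?_⟩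
  · rw [SimpleGraph.Walk.isPath_def, SimpleGraph.Walk.support_append, List.nodup_append']
    refine ⟨hp₁.support_nodup, hp₂.support_nodup.tail, ?_⟩
    intro v hv₁ hv₂
    have hm : p m ∉ W₂.support.tail := by
      have := hp₂.support_nodup
      rw [← SimpleGraph.Walk.cons_tail_support] at this
      exact (List.nodup_cons.1 this).1
    have h2 := (hs₂ v).1 (List.mem_of_mem_tail hv₂)
    have h1 := (hs₁ v).1 hv₁
    have hts := hp.ne hst
    have hms' := hp.ne hms
    have hmt' := hp.ne hmt
    have := hpJ s
    have := hpJ m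
    have := hpK t
    have : v ∈ J → v ∉ K := fun h => Finset.disjoint_left.1 hd h
    grind
  · intro e he
    rw [SimpleGraph.Walk.edges_append, List.mem_append] at he
    rcases he with he | he
    · rcases he₁ e he with ⟨v, hv, hvJ⟩ | ⟨h, rfl⟩
      · exact Or.inl ⟨v, hv, Or.inl hvJ⟩
      · exact Or.inr ⟨t, m, hmt.symm, rfl, Or.inl ⟨h, hst.symm, hms⟩⟩
    · rcases he₂ e he with ⟨v, hv, hvJ⟩ | ⟨h, rfl⟩
      · exact Or.inl ⟨v, hv, Or.inr hvJ⟩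
      · exact Or.inr ⟨m, s, hms, rfl, Or.inr ⟨h, hmt, hst⟩⟩

lemma exists_split_of_forall_mem {p : Fin 3 → V} (hp : Function.Injective p) {L : List V}
    (hL : ∀ a, p a ∈ L) : ∃ a b c : Fin 3, a ≠ b ∧ a ≠ c ∧ b ≠ c ∧ ∃ l₀ l₁ l₂ l₃ : List V,
      L = l₀ ++ p a :: (l₁ ++ p b :: (l₂ ++ p c :: l₃)) := by
  have h01 : p 1 ≠ p 0 := hp.ne (by decide)
  have h02 : p 2 ≠ p 0 := hp.ne (by decide)
  have h12 : p 2 ≠ p 1 := hp.ne (by decide)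
  obtain ⟨A, B, rfl⟩ := List.append_of_mem (hL 0)
  have h1 := hL 1
  have h2 := hL 2
  simp only [List.mem_append, List.mem_cons, h01, h02, false_or] at h1 h2
  rcases h1 with h1 | h1 <;> obtain ⟨C, D, rfl⟩ := List.append_of_mem h1 <;>
    simp only [List.mem_append, List.mem_cons, h12, false_or] at h2
  · rcases h2 with (h2 | h2) | h2 <;> obtain ⟨E, F, rfl⟩ := List.append_of_mem h2
    · exact ⟨2, 1, 0, by decide, by decide, by decide, E, F, D, B, by simp⟩
    · exact ⟨1, 2, 0, by decide, by decide, by decide, C, E, F, B, by simp⟩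
    · exact ⟨1, 0, 2, by decide, by decide, by decide, C, D, E, F, by simp⟩
  · rcases h2 with h2 | h2 | h2 <;> obtain ⟨E, F, rfl⟩ := List.append_of_mem h2
    · exact ⟨2, 0, 1, by decide, by decide, by decide, E, F, C, D, by simp⟩
    · exact ⟨0, 2, 1, by decide, by decide, by decide, A, E, F, D, by simp⟩
    · exact ⟨0, 1, 2, by decide, by decide, by decide, A, C, E, F, by simp⟩

lemma exists_links_of_steinerPath {p : Fin 3 → V} (hp : Function.Injective p)
    (P : SteinerPath G (Set.range p)) :
    ∃ (s t : Fin 3) (J K : Finset V), s ≠ t ∧ TLink G p s J ∧ TLink G p t K ∧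
      (∀ a, p a ∉ J) ∧ (∀ a, p a ∉ K) ∧ Disjoint J K ∧
      (∀ v ∈ J, v ∈ P.walk.support) ∧ (∀ v ∈ K, v ∈ P.walk.support) ∧
      (J = ∅ → ∀ a b, a ≠ b → a ≠ s → b ≠ s → s(p a, p b) ∈ P.walk.edges) ∧
      (K = ∅ → ∀ a b, a ≠ b → a ≠ t → b ≠ t → s(p a, p b) ∈ P.walk.edges) := by
  classical
  obtain ⟨a, b, c, hab, hac, hbc, l₀, l₁, l₂, l₃, hL⟩ :=
    exists_split_of_forall_mem hp fun a => P.contains _ ⟨a, rfl⟩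
  have hn := P.isPath.support_nodup
  have hc := P.walk.isChain_adj_support
  have hall : ∀ d : Fin 3, d = a ∨ d = b ∨ d = c := by omega
  have hedge : ∀ u v, [u, v] <:+: P.walk.support → s(u, v) ∈ P.walk.edges := fun u v h =>
    SimpleGraph.Walk.infix_support_iff_mem_edges.1 (Or.inl h)
  have hsub : ∀ v, v ∈ l₁ ∨ v ∈ l₂ → v ∈ P.walk.support := by
    intro v hv
    rw [hL]
    simp only [List.mem_append, List.mem_cons]
    tauto
  rw [hL] at hn hc hedge
  obtain ⟨hc₁, hc'⟩ := (List.isChain_split (l₁ := p a :: l₁)).1 (List.isChain_split.1 hc).2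
  have hc₂ := ((List.isChain_split (l₁ := p b :: l₂)).1 hc').1
  refine ⟨c, a, l₁.toFinset, l₂.toFinset, hac.symm,
    tLink_of_link hab hac hbc ⟨l₁, hc₁, by grind, fun v => List.mem_toFinset.symm⟩,
    tLink_of_link hbc hab.symm hac.symm ⟨l₂, hc₂, by grind, fun v => List.mem_toFinset.symm⟩,
    ?_, ?_, ?_, fun v hv => hsub v (Or.inl (List.mem_toFinset.1 hv)),
    fun v hv => hsub v (Or.inr (List.mem_toFinset.1 hv)), ?_, ?_⟩
  · intro d hd
    rw [List.mem_toFinset] at hd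
    rcases hall d with rfl | rfl | rfl <;> grind
  · intro d hd
    rw [List.mem_toFinset] at hd
    rcases hall d with rfl | rfl | rfl <;> grind
  · rw [Finset.disjoint_left]
    intro v hv hv'
    rw [List.mem_toFinset] at hv hv'
    grind
  · intro h d e hde hd he
    obtain rfl := List.toFinset_eq_empty_iff _ |>.1 h
    have := hedge (p a) (p b) ⟨l₀, l₂ ++ p c :: l₃, by simp⟩
    obtain ⟨rfl, rfl⟩ | ⟨rfl, rfl⟩ : (d = a ∧ e = b) ∨ (d = b ∧ e = a) := by omega
    · exact this
    · rwa [Sym2.eq_swap]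
  · intro h d e hde hd he
    obtain rfl := List.toFinset_eq_empty_iff _ |>.1 h
    have := hedge (p b) (p c) ⟨l₀ ++ p a :: l₁, l₃, by simp⟩
    obtain ⟨rfl, rfl⟩ | ⟨rfl, rfl⟩ : (d = b ∧ e = c) ∨ (d = c ∧ e = b) := by omega
    · exact this
    · rwa [Sym2.eq_swap]

variable {p : Fin 3 → V}

/-- A family of internally disjoint links between the terminals; `τ i` is the terminal which the
`i`-th link misses and `I i` is its interior. -/
structure IsLinkSystem (G : SimpleGraph V) (p : Fin 3 → V) {n : ℕ} (τ : Fin n → Fin 3)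
    (I : Fin n → Finset V) : Prop where
  link : ∀ i, TLink G p (τ i) (I i)
  notMem : ∀ i a, p a ∉ I i
  disj : ∀ i j, i ≠ j → Disjoint (I i) (I j)
  ne_empty : ∀ i j, i ≠ j → τ i = τ j → I i = ∅ → I j ≠ ∅

/-- The number of indices of type `c`. -/
def cnt {n : ℕ} (τ : Fin n → Fin 3) (c : Fin 3) : ℕ :=
  ∑ i, if τ i = c then 1 else 0

lemma sum_update_add {n : ℕ} (f : Fin n → ℕ) (i : Fin n) (b : ℕ) :
    ∑ j, Function.update f i b j + f i = ∑ j, f j + b := by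
  rw [Finset.sum_update_of_mem (Finset.mem_univ i),
    ← Finset.sum_sdiff (Finset.subset_univ {i}) (f := f), Finset.sum_singleton]
  omega

lemma cnt_update {n : ℕ} (τ : Fin n → Fin 3) (i : Fin n) (c d : Fin 3) :
    cnt (Function.update τ i c) d + (if τ i = d then 1 else 0) =
      cnt τ d + if c = d then 1 else 0 := by
  rw [cnt, cnt, ← sum_update_add (fun j => if τ j = d then 1 else 0) i]
  congr 2
  ext j
  rcases eq_or_ne j i with rfl | h
  · simp
  · simp [h]

lemma sum_card_update {n : ℕ} (I : Fin n → Finset V) (i : Fin n) (J : Finset V) :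
    ∑ j, (Function.update I i J j).card + (I i).card = ∑ j, (I j).card + J.card := by
  rw [← sum_update_add (fun j => (I j).card) i]
  congr 2
  ext j
  rcases eq_or_ne j i with rfl | h
  · simp
  · simp [h]

lemma cnt_add {n : ℕ} (τ : Fin n → Fin 3) {a b c : Fin 3} (hab : a ≠ b) (hac : a ≠ c)
    (hbc : b ≠ c) : cnt τ a + cnt τ b + cnt τ c = n := by
  simp only [cnt]
  rw [← Finset.sum_add_distrib, ← Finset.sum_add_distrib]
  calc _ = ∑ _i : Fin n, 1 := Finset.sum_congr rfl fun i _ => by grind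
    _ = n := by simp

lemma cnt_pos {n : ℕ} {τ : Fin n → Fin 3} (i : Fin n) : 0 < cnt τ (τ i) :=
  Finset.sum_pos' (fun _ _ => Nat.zero_le _) ⟨i, Finset.mem_univ i, by simp⟩

lemma cnt_eq_card {n : ℕ} (τ : Fin n → Fin 3) (c : Fin 3) :
    cnt τ c = (Finset.univ.filter fun i => τ i = c).card := by
  rw [cnt, Finset.card_filter]

lemma IsLinkSystem.update {n : ℕ} {τ : Fin n → Fin 3} {I : Fin n → Finset V}
    (h : IsLinkSystem G p τ I) {i : Fin n} {c : Fin 3} {J : Finset V} (hJI : J ⊆ I i)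
    (hne : J = ∅ → ∀ j, τ j = c → I j ≠ ∅) (hJ : TLink G p c J) :
    IsLinkSystem G p (Function.update τ i c) (Function.update I i J) := by
  classical
  refine ⟨fun j => ?_, fun j a => ?_, fun j k hjk => ?_, fun j k hjk => ?_⟩
  · rcases eq_or_ne j i with rfl | hj
    · simpa using hJ
    · simpa [hj] using h.link j
  · rcases eq_or_ne j i with rfl | hj
    · simpa using fun ha => h.notMem j a (hJI ha)
    · simpa [hj] using h.notMem j a
  · rcases eq_or_ne j i with rfl | hj
    · simpa [hjk.symm] using (h.disj j k hjk).mono_left hJI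
    · rcases eq_or_ne k i with rfl | hk
      · simpa [hj] using (h.disj j k hjk).mono_right hJI
      · simpa [hj, hk] using h.disj j k hjk
  · rcases eq_or_ne j i with rfl | hj
    · simp only [Function.update_self, Function.update_of_ne hjk.symm]
      exact fun h1 h2 => hne h2 k h1.symm
    · rcases eq_or_ne k i with rfl | hk
      · simp only [Function.update_self, Function.update_of_ne hj]
        exact fun h1 h2 h3 => hne h3 j h1 h2
      · simpa [hj, hk] using h.ne_empty j k hjk

/-- A link system in which no type occurs more than `m` times, of least total length. -/
structure IsMinimalSystem (G : SimpleGraph V) (p : Fin 3 → V) (m : ℕ) (τ : Fin (m + m) → Fin 3)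
    (I : Fin (m + m) → Finset V) : Prop where
  sys : IsLinkSystem G p τ I
  cnt_le : ∀ c, cnt τ c ≤ m
  le : ∀ (τ' : Fin (m + m) → Fin 3) (I' : Fin (m + m) → Finset V),
    IsLinkSystem G p τ' I' → (∀ c, cnt τ' c ≤ m) → ∑ i, (I i).card ≤ ∑ i, (I' i).card

namespace IsMinimalSystem

variable {m : ℕ} {τ : Fin (m + m) → Fin 3} {I : Fin (m + m) → Finset V}

lemma card_le (h : IsMinimalSystem G p m τ I) {i : Fin (m + m)} {c : Fin 3} {J : Finset V}
    (hJI : J ⊆ I i) (hne : J = ∅ → ∀ j, τ j = c → I j ≠ ∅) (hJ : TLink G p c J)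
    (hc : τ i = c ∨ cnt τ c < m) : (I i).card ≤ J.card := by
  have := h.le _ _ (h.sys.update hJI hne hJ) fun d => by
    have := cnt_update τ i c d
    have := h.cnt_le d
    grind
  have := sum_card_update I i J
  omega

lemma exists_empty (h : IsMinimalSystem G p m τ I) (hm : 2 ≤ m) {a b s : Fin 3} (hab : a ≠ b)
    (has : a ≠ s) (hbs : b ≠ s) (hadj : G.Adj (p a) (p b)) : ∃ i, τ i = s ∧ I i = ∅ := by
  by_contra! hcon
  have key : ∀ i, I i ≠ ∅ → (τ i = s ∨ cnt τ s < m) → False := fun i hi hc => by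
    have := h.card_le (i := i) (Finset.empty_subset _) (fun _ j hj => (hcon j hj).ne_empty)
      (tLink_of_link hab has hbs (link_empty.2 hadj)) hc
    exact hi (Finset.card_eq_zero.1 (by simpa using this))
  by_cases hs : ∃ i, τ i = s
  · obtain ⟨i, hi⟩ := hs
    exact key i (hcon i hi).ne_empty (Or.inl hi)
  · have hs0 : cnt τ s = 0 := by
      push Not at hs
      simp [cnt, hs]
    have h1 := cnt_add τ hab has hbs
    have h2 := h.cnt_le a
    have h3 := h.cnt_le b
    have h4 : 1 < (Finset.univ.filter fun i => τ i = a).card := by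
      rw [← cnt_eq_card]
      omega
    obtain ⟨i, hi, j, hj, hij⟩ := Finset.one_lt_card.1 h4
    simp only [Finset.mem_filter, Finset.mem_univ, true_and] at hi hj
    by_cases hI : I i = ∅
    · exact key j (h.sys.ne_empty i j hij (hi.trans hj.symm) hI) (Or.inr (by omega))
    · exact key i hI (Or.inr (by omega))

/-- If a link with at least two interior vertices is adjacent to the terminal it misses, then for
some terminal `a` half of the links miss `a`, and none of these is adjacent to `a`. -/
lemma exists_cnt_eq (h : IsMinimalSystem G p m τ I) {i : Fin (m + m)} {w : V} (hw : w ∈ I i)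
    (hadj : G.Adj (p (τ i)) w) (hcard : 2 ≤ (I i).card) :
    ∃ a, cnt τ a = m ∧ ∀ j, τ j = a → ∀ v ∈ I j, ¬ G.Adj (p a) v := by
  obtain ⟨a, b, hab, ha, hb, hcnt⟩ : ∃ a b, a ≠ b ∧ a ≠ τ i ∧ b ≠ τ i ∧ cnt τ a = m := by
    obtain ⟨a, b, hab, ha, hb⟩ :=
      (by decide : ∀ c : Fin 3, ∃ a b, a ≠ b ∧ a ≠ c ∧ b ≠ c) (τ i)
    obtain ⟨J₁, hJ₁, J₂, hJ₂, hw₁, hw₂, hJ, hlink⟩ := (h.sys.link i a b hab ha hb).split hw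
    by_contra! hcon
    have h1 := (h.cnt_le a).lt_of_ne (hcon a b hab ha hb)
    have h2 := (h.cnt_le b).lt_of_ne (hcon b a hab.symm hb ha)
    have h3 := h.card_le hJ₁ (fun h0 => by simp [h0] at hw₁)
      (tLink_of_link ha hab hb.symm (hlink _ hadj.symm).1) (Or.inr h2)
    have h4 := h.card_le hJ₂ (fun h0 => by simp [h0] at hw₂)
      (tLink_of_link hb hab.symm ha.symm (hlink _ hadj.symm).2) (Or.inr h1)
    omega
  refine ⟨a, hcnt, fun j hj v hv hav => ?_⟩
  subst hj
  obtain ⟨J₁, hJ₁, J₂, hJ₂, hw₁, hw₂, hJ, hlink⟩ := (h.sys.link i _ b hab ha hb).split hw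
  obtain ⟨K, hK, _, -, hvK, -, -, hlinkK⟩ :=
    (h.sys.link j b (τ i) hb hab.symm ha.symm).split hv
  have hij : i ≠ j := fun hij => ha (congrArg τ hij.symm)
  have hsys : IsLinkSystem G p (Function.update τ j (τ i)) (Function.update I j K) :=
    h.sys.update hK (fun h0 => by simp [h0] at hvK)
      (tLink_of_link hab.symm hb ha (hlinkK _ hav.symm).1)
  have hK' := Finset.card_le_card hK
  have hIi : Function.update I j K i = I i := Function.update_of_ne hij _ _
  have hτi : Function.update τ j (τ i) i = τ i := Function.update_of_ne hij _ _
  have hsum := sum_card_update I j K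
  have hcntadd := cnt_add τ hab ha hb
  have hpos := cnt_pos (τ := τ) i
  have hmin : ∀ c L, L ⊆ I i → w ∈ L → TLink G p c L → c ≠ τ i → (I i).card ≤ L.card := by
    intro c L hL hwL hlinkL hc
    have := h.le _ _ (hsys.update (i := i) (hIi.symm ▸ hL) (fun h0 => by simp [h0] at hwL) hlinkL)
      fun d => by
        have h1 := cnt_update (Function.update τ j (τ i)) i c d
        have h2 := cnt_update τ j (τ i) d
        have h3 := h.cnt_le d
        rw [hτi] at h1
        grind
    have := sum_card_update (Function.update I j K) i L
    rw [hIi] at this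
    omega
  have h1 := hmin _ J₂ hJ₂ hw₂ (tLink_of_link hb hab.symm ha.symm (hlink _ hadj.symm).2) ha
  have h2 := hmin _ J₁ hJ₁ hw₁ (tLink_of_link ha hab hb.symm (hlink _ hadj.symm).1) hb
  omega

end IsMinimalSystem

open scoped Classical in
/-- The neighbours of the terminal `p s` for which the `i`-th link accounts. -/
noncomputable def linkNeighbors (G : SimpleGraph V) (p : Fin 3 → V) {n : ℕ} (τ : Fin n → Fin 3)
    (I : Fin n → Finset V) (s : Fin 3) (i : Fin n) : Finset V :=
  if I i = ∅ then (if s = τ i then ∅ else {p (-(s + τ i))}) else (I i).filter (G.Adj (p s))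

namespace IsMinimalSystem

variable {m : ℕ} {τ : Fin (m + m) → Fin 3} {I : Fin (m + m) → Finset V}

lemma card_linkNeighbors_le_one (h : IsMinimalSystem G p m τ I) {s : Fin 3} {i : Fin (m + m)}
    (hs : s ≠ τ i) : (linkNeighbors G p τ I s i).card ≤ 1 := by
  classical
  rw [linkNeighbors, if_neg hs]
  split_ifs with hI
  · simp
  · rw [Finset.card_le_one]
    intro v hv w hw
    rw [Finset.mem_filter] at hv hw
    obtain ⟨b, hb, hbs⟩ := (by decide : ∀ s c : Fin 3, ∃ b, b ≠ c ∧ s ≠ b) s (τ i)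
    refine (h.sys.link i s b hbs hs hb).neighbor_unique (fun J hJ hne hlink => ?_) hv.1 hw.1
      hv.2 hw.2
    exact h.card_le hJ (fun h0 => absurd h0 hne.ne_empty) (tLink_of_link hbs hs hb hlink)
      (Or.inl rfl)

lemma le_sum_card_linkNeighbors (h : IsMinimalSystem G p m τ I) (hm : 2 ≤ m) {k : ℕ}
    (hreg : ∀ v, (G.neighborSet v).ncard = k)
    (hcov : ∀ s u, G.Adj (p s) u → u ∈ Set.range p ∨ ∃ i, u ∈ I i) (s : Fin 3) :
    k ≤ ∑ i, (linkNeighbors G p τ I s i).card := by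
  classical
  refine le_trans ?_ Finset.card_biUnion_le
  rw [← hreg (p s), ← Set.ncard_coe_finset]
  refine Set.ncard_le_ncard (fun u hu => ?_) (Finset.finite_toSet _)
  rw [Finset.mem_coe, Finset.mem_biUnion]
  rcases hcov s u hu with ⟨b, rfl⟩ | ⟨i, hi⟩
  · have hsb : s ≠ b := fun hsb => G.ne_of_adj hu (congrArg p hsb)
    obtain ⟨hc₁, hc₂, hc₃⟩ := (by decide : ∀ s b : Fin 3, s ≠ b →
      s ≠ -(s + b) ∧ b ≠ -(s + b) ∧ -(s + -(s + b)) = b) s b hsb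
    obtain ⟨i, hi, hI⟩ := h.exists_empty hm hsb hc₁ hc₂ hu
    refine ⟨i, Finset.mem_univ i, ?_⟩
    rw [linkNeighbors, if_pos hI, hi, if_neg hc₁, hc₃]
    exact Finset.mem_singleton_self _
  · refine ⟨i, Finset.mem_univ i, ?_⟩
    rw [linkNeighbors, if_neg (Finset.ne_empty_of_mem hi)]
    exact Finset.mem_filter.2 ⟨hi, hu⟩

/-- A minimal system misses a neighbour of some terminal. -/
lemma exists_adj_notMem (h : IsMinimalSystem G p m τ I) (hm : 2 ≤ m) {k : ℕ}
    (hreg : ∀ v, (G.neighborSet v).ncard = k)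
    (hk : 4 * m + {w | ∀ s, G.Adj (p s) w}.ncard + 1 ≤ 3 * k) :
    ∃ s u, G.Adj (p s) u ∧ u ∉ Set.range p ∧ ∀ i, u ∉ I i := by
  classical
  by_contra! hcov
  replace hcov : ∀ s u, G.Adj (p s) u → u ∈ Set.range p ∨ ∃ i, u ∈ I i := fun s u hu =>
    or_iff_not_imp_left.2 (hcov s u hu)
  have hle := h.le_sum_card_linkNeighbors hm hreg hcov
  have hone := fun s i => h.card_linkNeighbors_le_one (s := s) (i := i)
  by_cases hbig : ∃ i, ∃ w ∈ I i, G.Adj (p (τ i)) w ∧ 2 ≤ (I i).card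
  · obtain ⟨i, w, hw, hadj, hcard⟩ := hbig
    obtain ⟨a, ha, hna⟩ := h.exists_cnt_eq hw hadj hcard
    obtain ⟨b, c, hab, hac, hbc⟩ :=
      (by decide : ∀ a : Fin 3, ∃ b c, a ≠ b ∧ a ≠ c ∧ b ≠ c) a
    have hcnt := cnt_add τ hab hac hbc
    have : ∑ j, (linkNeighbors G p τ I a j).card ≤ cnt τ b + cnt τ c := by
      rw [cnt, cnt, ← Finset.sum_add_distrib]
      refine Finset.sum_le_sum fun j _ => ?_
      by_cases hj : a = τ j
      · have : linkNeighbors G p τ I a j = ∅ := by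
          rw [linkNeighbors, if_pos hj, ite_eq_left_iff, Finset.filter_eq_empty_iff]
          exact fun _ v hv => hna j hj.symm v hv
        simp [this]
      · have := hone a j hj
        grind
    have := hle a
    omega
  · push Not at hbig
    set B := Finset.univ.filter fun i => ∃ w, I i = {w} ∧ ∀ s, G.Adj (p s) w with hB
    have hBle : B.card ≤ {w | ∀ s, G.Adj (p s) w}.ncard := by
      have hfin : {w | ∀ s, G.Adj (p s) w}.Finite := by
        refine Set.Finite.subset (s := G.neighborSet (p 0)) ?_ fun w hw => hw 0
        refine Set.finite_of_ncard_pos ?_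
        rw [hreg]
        omega
      calc B.card = ∑ i ∈ B, (I i).card := by
            rw [Finset.card_eq_sum_ones]
            refine Finset.sum_congr rfl fun i hi => ?_
            obtain ⟨w, hw, -⟩ := (Finset.mem_filter.1 hi).2
            simp [hw]
        _ = (B.biUnion I).card :=
            (Finset.card_biUnion fun i _ j _ hij => h.sys.disj i j hij).symm
        _ ≤ _ := by
            rw [← Set.ncard_coe_finset]
            refine Set.ncard_le_ncard (fun v hv => ?_) hfin
            obtain ⟨i, hi, hv⟩ := Finset.mem_biUnion.1 (Finset.mem_coe.1 hv)
            obtain ⟨w, hw, hadj⟩ := (Finset.mem_filter.1 hi).2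
            rw [hw, Finset.mem_singleton] at hv
            exact hv ▸ hadj
    have hmiss : ∀ i, (linkNeighbors G p τ I (τ i) i).card ≤ if i ∈ B then 1 else 0 := by
      intro i
      rcases Finset.eq_empty_or_nonempty (linkNeighbors G p τ I (τ i) i) with h0 | ⟨w, hw⟩
      · simp [h0]
      · rw [linkNeighbors, if_pos rfl] at hw ⊢
        have hI : I i ≠ ∅ := fun hI => by simp [hI] at hw
        rw [if_neg hI, Finset.mem_filter] at hw
        rw [if_neg hI]
        have h1 := hbig i w hw.1 hw.2
        have h2 := Finset.card_pos.2 ⟨w, hw.1⟩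
        obtain ⟨w', hw'⟩ := Finset.card_eq_one.1 (by omega : (I i).card = 1)
        obtain rfl : w = w' := by simpa [hw'] using hw.1
        have hiB : i ∈ B := by
          refine Finset.mem_filter.2 ⟨Finset.mem_univ i, w, hw', fun s => ?_⟩
          by_cases hs : s = τ i
          · exact hs ▸ hw.2
          · obtain ⟨b, hb, hbs⟩ := (by decide : ∀ s c : Fin 3, ∃ b, b ≠ c ∧ s ≠ b) s (τ i)
            have := h.sys.link i s b hbs hs hb
            rw [hw'] at this
            exact this.adj_of_singleton.1
        rw [if_pos hiB]
        exact (Finset.card_filter_le _ _).trans (by omega)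
    have hsum : ∑ i, ∑ s, (linkNeighbors G p τ I s i).card ≤
        ∑ i : Fin (m + m), (2 + if i ∈ B then 1 else 0) := by
      refine Finset.sum_le_sum fun i _ => ?_
      have h0 := hmiss i
      have h1 := hone 0 i
      have h2 := hone 1 i
      have h3 := hone 2 i
      rw [Fin.sum_univ_three]
      obtain hi | hi | hi := (by decide : ∀ c : Fin 3, c = 0 ∨ c = 1 ∨ c = 2) (τ i) <;>
        rw [hi] at h0 h1 h2 h3
      · have := h2 (by decide)
        have := h3 (by decide)
        omega
      · have := h1 (by decide)
        have := h3 (by decide)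
        omega
      · have := h1 (by decide)
        have := h2 (by decide)
        omega
    rw [Finset.sum_comm, Fin.sum_univ_three, Finset.sum_add_distrib, Finset.sum_const,
      Finset.card_univ, Fintype.card_fin, smul_eq_mul, ← Finset.card_filter,
      Finset.filter_mem_eq_inter, Finset.univ_inter] at hsum
    have := hle 0
    have := hle 1
    have := hle 2
    omega

end IsMinimalSystem

/-- A family of internally disjoint Steiner paths decomposes into a link system. -/
lemma exists_isLinkSystem (hp : Function.Injective p) {m : ℕ}
    {P : Fin m → SteinerPath G (Set.range p)} (hP : IDFamily G (Set.range p) P) :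
    ∃ (τ : Fin (m + m) → Fin 3) (I : Fin (m + m) → Finset V),
      IsLinkSystem G p τ I ∧ ∀ c, cnt τ c ≤ m := by
  choose s t J K hst hJ hK hpJ hpK hd hJs hKs hJe hKe using
    fun i => exists_links_of_steinerPath hp (P i)
  have hdisj : ∀ i j, i ≠ j → ∀ A B : Finset V, (∀ a, p a ∉ A) →
      (∀ v ∈ A, v ∈ (P i).walk.support) → (∀ v ∈ B, v ∈ (P j).walk.support) →
      Disjoint A B := by
    intro i j hij A B hpA hA hB
    rw [Finset.disjoint_left]
    intro v hvA hvB
    have : v ∈ Set.range p := (hP i j hij).1 ▸ ⟨hA v hvA, hB v hvB⟩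
    obtain ⟨a, rfl⟩ := this
    exact hpA a hvA
  have hne : ∀ i j, i ≠ j → ∀ (c : Fin 3) (A B : Finset V),
      (A = ∅ → ∀ a b, a ≠ b → a ≠ c → b ≠ c → s(p a, p b) ∈ (P i).walk.edges) →
      (B = ∅ → ∀ a b, a ≠ b → a ≠ c → b ≠ c → s(p a, p b) ∈ (P j).walk.edges) →
      A = ∅ → B ≠ ∅ := by
    intro i j hij c A B hA hB hA0 hB0
    obtain ⟨a, b, hab, ha, hb⟩ :=
      (by decide : ∀ c : Fin 3, ∃ a b, a ≠ b ∧ a ≠ c ∧ b ≠ c) c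
    exact (hP i j hij).2 _ (hA hA0 a b hab ha hb) (hB hB0 a b hab ha hb)
  refine ⟨Fin.addCases s t, Fin.addCases J K, ⟨fun i => ?_, fun i => ?_, fun i j => ?_,
    fun i j => ?_⟩, fun c => ?_⟩
  · induction i using Fin.addCases with
    | left i => simpa only [Fin.addCases_left] using hJ i
    | right i => simpa only [Fin.addCases_right] using hK i
  · induction i using Fin.addCases with
    | left i => simpa only [Fin.addCases_left] using hpJ i
    | right i => simpa only [Fin.addCases_right] using hpK i
  · induction i using Fin.addCases with
    | left i =>
      induction j using Fin.addCases with
      | left j =>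
        simp only [Fin.addCases_left]
        exact fun h => hdisj i j (fun h' => h (by rw [h'])) _ _ (hpJ i) (hJs i) (hJs j)
      | right j =>
        simp only [Fin.addCases_left, Fin.addCases_right]
        rcases eq_or_ne i j with rfl | hij
        · exact fun _ => hd i
        · exact fun _ => hdisj i j hij _ _ (hpJ i) (hJs i) (hKs j)
    | right i =>
      induction j using Fin.addCases with
      | left j =>
        simp only [Fin.addCases_left, Fin.addCases_right]
        rcases eq_or_ne i j with rfl | hij
        · exact fun _ => (hd i).symm
        · exact fun _ => hdisj i j hij _ _ (hpK i) (hKs i) (hJs j)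
      | right j =>
        simp only [Fin.addCases_right]
        exact fun h => hdisj i j (fun h' => h (by rw [h'])) _ _ (hpK i) (hKs i) (hKs j)
  · induction i using Fin.addCases with
    | left i =>
      induction j using Fin.addCases with
      | left j =>
        simp only [Fin.addCases_left]
        exact fun h hc => hne i j (fun h' => h (by rw [h'])) (s i) _ _ (hJe i) (hc ▸ hJe j)
      | right j =>
        simp only [Fin.addCases_left, Fin.addCases_right]
        rcases eq_or_ne i j with rfl | hij
        · exact fun _ hc => absurd hc (hst i)
        · exact fun _ hc => hne i j hij (s i) _ _ (hJe i) (hc ▸ hKe j)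
    | right i =>
      induction j using Fin.addCases with
      | left j =>
        simp only [Fin.addCases_left, Fin.addCases_right]
        rcases eq_or_ne i j with rfl | hij
        · exact fun _ hc => absurd hc.symm (hst i)
        · exact fun _ hc => hne i j hij (t i) _ _ (hKe i) (hc ▸ hJe j)
      | right j =>
        simp only [Fin.addCases_right]
        exact fun h hc => hne i j (fun h' => h (by rw [h'])) (t i) _ _ (hKe i) (hc ▸ hKe j)
  · rw [cnt, Fin.sum_univ_add, ← Finset.sum_add_distrib]
    simp only [Fin.addCases_left, Fin.addCases_right]
    calc _ ≤ ∑ _i : Fin m, 1 := Finset.sum_le_sum fun i _ => by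
          have := hst i
          grind
      _ = m := by simp

/-- If each type occurs at most `m` times among `2 * m` indices, then the indices can be paired
so that paired indices have different types. -/
lemma exists_pairing {m : ℕ} {τ : Fin (m + m) → Fin 3} (hτ : ∀ c, cnt τ c ≤ m) :
    ∃ σ : Equiv.Perm (Fin (m + m)), ∀ i : Fin m,
      τ (σ (Fin.castAdd m i)) ≠ τ (σ (Fin.natAdd m i)) := by
  refine ⟨Tuple.sort τ, fun i hi => ?_⟩
  have hmono := Tuple.monotone_sort τ
  have hsub : (Finset.Icc (Fin.castAdd m i) (Fin.natAdd m i)).map (Tuple.sort τ).toEmbedding ⊆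
      Finset.univ.filter fun j => τ j = τ (Tuple.sort τ (Fin.castAdd m i)) := by
    intro j hj
    obtain ⟨l, hl, rfl⟩ := Finset.mem_map.1 hj
    rw [Finset.mem_Icc] at hl
    rw [Finset.mem_filter]
    exact ⟨Finset.mem_univ _, le_antisymm ((hmono hl.2).trans hi.ge) (hmono hl.1)⟩
  have h1 := Finset.card_le_card hsub
  rw [← cnt_eq_card, Finset.card_map, Fin.card_Icc, Fin.val_natAdd, Fin.val_castAdd] at h1
  have h2 := hτ (τ (Tuple.sort τ (Fin.castAdd m i)))
  omega

/-- A balanced link system assembles into a family of internally disjoint Steiner paths. -/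
lemma IsLinkSystem.exists_idFamily (hp : Function.Injective p) {m : ℕ}
    {τ : Fin (m + m) → Fin 3} {I : Fin (m + m) → Finset V} (h : IsLinkSystem G p τ I)
    (hτ : ∀ c, cnt τ c ≤ m) :
    ∃ P : Fin m → SteinerPath G (Set.range p), IDFamily G (Set.range p) P ∧
      ∀ i, ∀ v ∈ (P i).walk.support, v ∈ Set.range p ∨ ∃ j, v ∈ I j := by
  obtain ⟨σ, hσ⟩ := exists_pairing hτ
  have hne : ∀ i : Fin m, σ (Fin.castAdd m i) ≠ σ (Fin.natAdd m i) := fun i hi =>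
    hσ i (congrArg τ hi)
  choose P hP hPe using fun i : Fin m => exists_steinerPath hp (hσ i) (h.link _) (h.link _)
    (h.notMem _) (h.notMem _) (h.disj _ _ (hne i))
  refine ⟨P, fun i j hij => ?_, fun i v hv => ?_⟩
  · have hcross : ∀ x y : Fin (m + m),
        (x = σ (Fin.castAdd m i) ∨ x = σ (Fin.natAdd m i)) →
        (y = σ (Fin.castAdd m j) ∨ y = σ (Fin.natAdd m j)) → x ≠ y := by
      rintro x y hx hy rfl
      have hij' : (i : ℕ) ≠ j := fun h => hij (Fin.ext h)
      have := i.isLt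
      have := j.isLt
      rcases hx with hx | hx <;> rcases hy with hy | hy <;>
        have := congrArg Fin.val (σ.injective (hx.symm.trans hy)) <;>
        simp only [Fin.val_castAdd, Fin.val_natAdd] at this <;> omega
    have hdis : ∀ v, (v ∈ I (σ (Fin.castAdd m i)) ∨ v ∈ I (σ (Fin.natAdd m i))) →
        v ∉ (P j).walk.support := by
      intro v hv hvj
      obtain ⟨x, hx, hvx⟩ : ∃ x, (x = σ (Fin.castAdd m i) ∨ x = σ (Fin.natAdd m i)) ∧
          v ∈ I x := by
        rcases hv with hv | hv
        exacts [⟨_, Or.inl rfl, hv⟩, ⟨_, Or.inr rfl, hv⟩]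
      rcases (hP j v).1 hvj with ⟨a, rfl⟩ | hvj | hvj
      · exact h.notMem x a hvx
      · exact Finset.disjoint_left.1 (h.disj _ _ (hcross x _ hx (Or.inl rfl))) hvx hvj
      · exact Finset.disjoint_left.1 (h.disj _ _ (hcross x _ hx (Or.inr rfl))) hvx hvj
    have htype : ∀ (a b c : Fin 3), a ≠ b → ∀ d, a ≠ c → b ≠ c → a ≠ d → b ≠ d → c = d := by
      decide
    constructor
    · ext v
      constructor
      · rintro ⟨hi, hj⟩
        rcases (hP i v).1 hi with h1 | h1
        · exact h1
        · exact absurd hj (hdis v h1)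
      · exact fun hv => ⟨(hP i v).2 (Or.inl hv), (hP j v).2 (Or.inl hv)⟩
    · intro e hei hej
      have hends : ∀ v ∈ e, v ∈ (P j).walk.support := fun v hv =>
        SimpleGraph.Walk.mem_support_of_mem_edges hej hv
      rcases hPe i e hei with ⟨v, hv, hvI⟩ | ⟨a, b, hab, rfl, he⟩
      · exact hdis v hvI (hends v hv)
      obtain ⟨x, hx, hIx, hax, hbx⟩ : ∃ x, (x = σ (Fin.castAdd m i) ∨ x = σ (Fin.natAdd m i)) ∧
          I x = ∅ ∧ a ≠ τ x ∧ b ≠ τ x := by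
        rcases he with he | he
        exacts [⟨_, Or.inl rfl, he⟩, ⟨_, Or.inr rfl, he⟩]
      rcases hPe j _ hej with ⟨v, hv, hvI⟩ | ⟨a', b', hab', heq, he⟩
      · obtain ⟨c, rfl⟩ : v ∈ Set.range p := by
          rcases Sym2.mem_iff.1 hv with rfl | rfl <;> exact ⟨_, rfl⟩
        rcases hvI with hvI | hvI <;> exact h.notMem _ _ hvI
      obtain ⟨y, hy, hIy, hay, hby⟩ : ∃ y, (y = σ (Fin.castAdd m j) ∨ y = σ (Fin.natAdd m j)) ∧
          I y = ∅ ∧ a' ≠ τ y ∧ b' ≠ τ y := by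
        rcases he with he | he
        exacts [⟨_, Or.inl rfl, he⟩, ⟨_, Or.inr rfl, he⟩]
      refine h.ne_empty x y (hcross x y hx hy) (htype a b _ hab _ hax hbx ?_ ?_) hIx hIy
      · rcases Sym2.eq_iff.1 heq with ⟨h1, h2⟩ | ⟨h1, h2⟩
        exacts [hp h1 ▸ hay, hp h1 ▸ hby]
      · rcases Sym2.eq_iff.1 heq with ⟨h1, h2⟩ | ⟨h1, h2⟩
        exacts [hp h2 ▸ hby, hp h2 ▸ hay]
  · rcases (hP i v).1 hv with h1 | h1 | h1
    exacts [Or.inl h1, Or.inr ⟨_, h1⟩, Or.inr ⟨_, h1⟩]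

lemma exists_isMinimalSystem {m : ℕ}
    (h : ∃ (τ : Fin (m + m) → Fin 3) (I : Fin (m + m) → Finset V),
      IsLinkSystem G p τ I ∧ ∀ c, cnt τ c ≤ m) :
    ∃ (τ : Fin (m + m) → Fin 3) (I : Fin (m + m) → Finset V), IsMinimalSystem G p m τ I := by
  obtain ⟨τ₀, I₀, h₀, hc₀⟩ := h
  obtain ⟨⟨τ, I⟩, hmem, hmin⟩ := exists_minimalFor_of_wellFoundedLT
    (fun q : (Fin (m + m) → Fin 3) × (Fin (m + m) → Finset V) =>
      IsLinkSystem G p q.1 q.2 ∧ ∀ c, cnt q.1 c ≤ m)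
    (fun q => ∑ i, (q.2 i).card) ⟨(τ₀, I₀), h₀, hc₀⟩
  refine ⟨τ, I, hmem.1, hmem.2, fun τ' I' h' hc' => ?_⟩
  exact (le_total _ _).elim id fun hle => hmin (j := (τ', I')) ⟨h', hc'⟩ hle

/-- If the path connectivity is positive, then every set of three terminals is joined by that many
internally disjoint Steiner paths. -/
lemma exists_idFamily_of_pathConnectivity_pos (hp : Function.Injective p)
    (hpos : 0 < pathConnectivity G 3) :
    ∃ P : Fin (pathConnectivity G 3) → SteinerPath G (Set.range p),
      IDFamily G (Set.range p) P := by
  classical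
  have hle : pathConnectivity G 3 ≤ steinerPathNumber G (Set.range p) := by
    refine Nat.sInf_le ⟨Finset.univ.map ⟨p, hp⟩, by simp, ?_⟩
    simp
  have hmem : steinerPathNumber G (Set.range p) ∈
      {t | ∃ P : Fin t → SteinerPath G (Set.range p), IDFamily G (Set.range p) P} := by
    refine Nat.sSup_mem ?_ ?_
    · by_contra hne
      rw [Set.not_nonempty_iff_eq_empty] at hne
      rw [steinerPathNumber, hne, csSup_empty, bot_eq_zero] at hle
      omega
    · by_contra hb
      rw [steinerPathNumber, Nat.sSup_of_not_bddAbove hb] at hle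
      omega
  obtain ⟨P, hP⟩ := hmem
  exact ⟨fun i => P (Fin.castLE hle i), fun i j hij =>
    hP _ _ fun h => hij (Fin.castLE_injective hle h)⟩

end SteinerLinks

/-- Lemma: if `3k - 4π₃(G) ≥ r + 1`, there is a maximum family of internally disjoint
`{x,y,z}`-paths avoiding some neighbour `u` of `x`, `y` or `z`. -/
theorem stmt10 {V : Type*} (G : SimpleGraph V) (k : ℕ)
    (hreg : ∀ v, (G.neighborSet v).ncard = k) (hconn : G.Connected)
    (hpi : 2 ≤ pathConnectivity G 3)
    (x y z : V) (hxy : x ≠ y) (hxz : x ≠ z) (hyz : y ≠ z)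
    (r : ℕ)
    (hr : (G.neighborSet x ∩ G.neighborSet y ∩ G.neighborSet z).ncard = r)
    (hineq : 4 * pathConnectivity G 3 + r + 1 ≤ 3 * k) :
    ∃ (u : V) (P : Fin (pathConnectivity G 3) → SteinerPath G {x, y, z}),
      IDFamily G {x, y, z} P ∧
      u ∈ G.neighborSet x ∪ G.neighborSet y ∪ G.neighborSet z ∧
      ∀ i, u ∉ (P i).walk.support := by
  have hp : Function.Injective ![x, y, z] := by
    intro a b
    fin_cases a <;> fin_cases b <;> simp_all [eq_comm]
  have hrange : Set.range ![x, y, z] = {x, y, z} := by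
    rw [Matrix.range_cons, Matrix.range_cons, Matrix.range_cons, Matrix.range_empty]
    ext v
    simp only [Set.mem_union, Set.mem_singleton_iff, Set.mem_insert_iff, Set.mem_empty_iff_false]
    tauto
  have hcommon : {w | ∀ s, G.Adj (![x, y, z] s) w} =
      G.neighborSet x ∩ G.neighborSet y ∩ G.neighborSet z := by
    ext w
    simp [Fin.forall_fin_succ, and_assoc]
  obtain ⟨P₀, hP₀⟩ := SteinerLinks.exists_idFamily_of_pathConnectivity_pos (G := G) hp (by omega)
  obtain ⟨τ, I, hmin⟩ :=
    SteinerLinks.exists_isMinimalSystem (SteinerLinks.exists_isLinkSystem hp hP₀)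
  obtain ⟨s, u, hsu, hu, huI⟩ := hmin.exists_adj_notMem hpi hreg (by rw [hcommon, hr]; exact hineq)
  obtain ⟨P, hP, hPI⟩ := hmin.sys.exists_idFamily hp hmin.cnt_le
  rw [← hrange]
  refine ⟨u, P, hP, ?_, fun i hi => (hPI i u hi).elim hu fun ⟨j, hj⟩ => huI j hj⟩
  fin_cases s
  · exact Or.inl (Or.inl hsu)
  · exact Or.inl (Or.inr hsu)
  · exact Or.inr hsu
end

section
/- Let G be a k-regular connected graph with π₃(G) ≥ 2, and let x, y, z be three distinct vertices with |N(x) ∩ N(y) ∩ N(z)| = r. If 3k - 4π₃(G) ≥ r + 3, then there exist two distinct vertices u, v and a set 𝒯 of π₃(G) internally disjoint {x,y,z}-paths such that u, v ∈ (N(x) ∪ N(y) ∪ N(z)) \ V(𝒯). -/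
open SimpleGraph

/-- `A` lists the inner vertices of a path of `G` from `p` to `q`, all of them outside `S`. -/
structure IsLink {V : Type*} (G : SimpleGraph V) (S : Finset V) (p q : V) (A : List V) : Prop where
  chain : (p :: (A ++ [q])).IsChain G.Adj
  nodup : A.Nodup
  off : ∀ v ∈ A, v ∉ S

namespace IsLink

variable {V : Type*} {G : SimpleGraph V} {S : Finset V} {p q r v : V} {A A₁ A₂ : List V}

theorem reverse (h : IsLink G S p q A) : IsLink G S q p A.reverse where
  chain := by
    rw [← List.isChain_reverse]
    simpa [G.adj_comm] using h.chain
  nodup := by simpa using h.nodup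
  off := by simpa using h.off

theorem nil (h : G.Adj p q) : IsLink G S p q [] :=
  ⟨by simpa using h, by simp, by simp⟩

theorem single (hp : G.Adj p v) (hq : G.Adj v q) (hv : v ∉ S) : IsLink G S p q [v] :=
  ⟨by simpa using ⟨hp, hq⟩, by simp, by simpa using hv⟩

theorem drop (h : IsLink G S p q (A₁ ++ v :: A₂)) (hr : G.Adj r v) :
    IsLink G S r q (v :: A₂) where
  chain := by
    have := h.chain
    rw [List.append_assoc, ← List.cons_append, List.isChain_append] at this
    simpa using ⟨hr, this.2.1⟩
  nodup := (List.nodup_append.1 h.nodup).2.1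
  off w hw := h.off w (by simp_all)

theorem take (h : IsLink G S p q (A₁ ++ v :: A₂)) (hr : G.Adj v r) :
    IsLink G S p r (A₁ ++ [v]) := by
  have h' := h.reverse
  rw [List.reverse_append, List.reverse_cons, List.append_assoc] at h'
  simpa using (h'.drop hr.symm).reverse

theorem adj_head (h : IsLink G S p q (v :: A)) : G.Adj p v := by
  have := h.chain
  simp at this
  exact this.1

theorem adj_last (h : IsLink G S p q (A ++ [v])) : G.Adj v q := by
  have h' := h.reverse
  simp only [List.reverse_append, List.reverse_cons, List.reverse_nil, List.nil_append,
    List.singleton_append] at h'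
  exact h'.adj_head.symm

/-- Every link is realised by a walk; its edges meet the inner vertices, unless there are none. -/
theorem exists_walk (h : (p :: (A ++ [q])).IsChain G.Adj) :
    ∃ w : G.Walk p q, w.support = p :: (A ++ [q]) ∧
      ∀ e ∈ w.edges, (A = [] ∧ e = s(p, q)) ∨ ∃ v ∈ A, v ∈ e := by
  induction A generalizing p with
  | nil =>
    have h : G.Adj p q := by simpa using h
    exact ⟨Walk.cons h Walk.nil, by simp, by simp⟩
  | cons a A ih =>
    have h' : G.Adj p a ∧ (a :: (A ++ [q])).IsChain G.Adj := by simpa using h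
    obtain ⟨w, hw, he⟩ := ih h'.2
    refine ⟨Walk.cons h'.1 w, by simp [hw], fun e hmem => Or.inr ?_⟩
    rw [Walk.edges_cons, List.mem_cons] at hmem
    rcases hmem with rfl | hmem
    · exact ⟨a, by simp, by simp⟩
    · rcases he e hmem with ⟨-, rfl⟩ | ⟨v, hv, hve⟩
      · exact ⟨a, by simp, by simp⟩
      · exact ⟨v, by simp [hv], hve⟩

end IsLink

/-- The raw data of a path through three terminals `a`, `m`, `b` in this order: the inner
vertices `A` of its `a`-`m` part and the inner vertices `B` of its `m`-`b` part. -/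
structure TriPath (V : Type*) where
  a : V
  m : V
  b : V
  A : List V
  B : List V

namespace TriPath

variable {V : Type*} [DecidableEq V] {G : SimpleGraph V} {S : Finset V}

/-- The non-terminal vertices. -/
def inner (T : TriPath V) : List V := T.A ++ T.B

/-- The edges joining two terminals. -/
def edges (T : TriPath V) : Set (Sym2 V) :=
  {e | (T.A = [] ∧ e = s(T.a, T.m)) ∨ (T.B = [] ∧ e = s(T.m, T.b))}

/-- The data do describe a path of `G` whose set of terminals is `S`. -/
structure Valid (G : SimpleGraph V) (S : Finset V) (T : TriPath V) : Prop where
  am : T.a ≠ T.m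
  mb : T.m ≠ T.b
  ab : T.a ≠ T.b
  terminals : S = {T.a, T.m, T.b}
  linkA : IsLink G S T.a T.m T.A
  linkB : IsLink G S T.m T.b T.B
  disj : T.A.Disjoint T.B

theorem Valid.nodup_inner {T : TriPath V} (h : Valid G S T) : T.inner.Nodup :=
  List.nodup_append'.2 ⟨h.linkA.nodup, h.linkB.nodup, h.disj⟩

theorem Valid.off {T : TriPath V} (h : Valid G S T) : ∀ v ∈ T.inner, v ∉ S := by
  intro v hv
  rcases List.mem_append.1 hv with hv | hv
  · exact h.linkA.off v hv
  · exact h.linkB.off v hv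

/-- Two descriptions with the same inner vertices and terminal edges, both of a path of `G`. -/
structure Equiv (G : SimpleGraph V) (S : Finset V) (T T' : TriPath V) : Prop where
  valid : Valid G S T'
  perm : T'.inner.Perm T.inner
  edges : T'.edges = T.edges

theorem Equiv.rfl {T : TriPath V} (h : Valid G S T) : Equiv G S T T := ⟨h, .refl _, Eq.refl _⟩

theorem Equiv.reverse {T : TriPath V} {p q s : V} {A B : List V}
    (h : Equiv G S T ⟨p, q, s, A, B⟩) : Equiv G S T ⟨s, q, p, B.reverse, A.reverse⟩ where
  valid :=
    { am := h.valid.mb.symm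
      mb := h.valid.am.symm
      ab := h.valid.ab.symm
      terminals := by rw [h.valid.terminals]; ext v; simp; tauto
      linkA := h.valid.linkB.reverse
      linkB := h.valid.linkA.reverse
      disj := by
        have := h.valid.disj
        intro v; have := @this v; simp_all; tauto }
  perm := by
    refine .trans ?_ h.perm
    simpa [inner] using List.reverse_perm (A ++ B)
  edges := by
    rw [← h.edges]; ext e; simp [TriPath.edges, Sym2.eq_swap (a := s), Sym2.eq_swap (a := q) (b := p)]
    tauto

/-- If the last inner vertex of the first part is adjacent to the far end, the second part
may be traversed backwards. -/
theorem Equiv.rotate {T : TriPath V} {p q s c : V} {A B : List V}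
    (h : Equiv G S T ⟨p, q, s, A ++ [c], B⟩) (hc : G.Adj c s) :
    Equiv G S T ⟨p, s, q, A ++ [c], B.reverse⟩ where
  valid :=
    { am := h.valid.ab
      mb := h.valid.mb.symm
      ab := h.valid.am
      terminals := by rw [h.valid.terminals]; ext v; simp; tauto
      linkA := h.valid.linkA.take hc
      linkB := h.valid.linkB.reverse
      disj := by
        have := h.valid.disj
        intro v; have := @this v; simp_all }
  perm := by
    refine .trans ?_ h.perm
    exact (List.reverse_perm B).append_left (A ++ [c])
  edges := by
    rw [← h.edges]; ext e; simp [TriPath.edges, Sym2.eq_swap (a := s)]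

end TriPath

open TriPath

/-- A family of pairwise internally disjoint paths with terminal set `S`. -/
structure IsTriFamily {V ι : Type*} [DecidableEq V] (G : SimpleGraph V) (S : Finset V)
    (F : ι → TriPath V) : Prop where
  valid : ∀ i, Valid G S (F i)
  disj : ∀ i j, i ≠ j → (F i).inner.Disjoint (F j).inner
  edges : ∀ i j, i ≠ j → Disjoint (F i).edges (F j).edges

/-- A family of pairwise internally disjoint paths with as few inner vertices as possible. -/
structure IsMinTriFamily {V ι : Type*} [DecidableEq V] [Fintype ι] (G : SimpleGraph V)
    (S : Finset V) (F : ι → TriPath V) : Prop where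
  toIsTriFamily : IsTriFamily G S F
  le : ∀ F' : ι → TriPath V, IsTriFamily G S F' → ∑ i, (F i).inner.length ≤ ∑ i, (F' i).inner.length

namespace IsMinTriFamily

variable {V ι : Type*} [DecidableEq V] [Fintype ι] {G : SimpleGraph V}
  {S : Finset V} {F : ι → TriPath V} {i j : ι} {T T₁ T₂ T' T₁' T₂' : TriPath V}

theorem exists_of_isTriFamily (h : IsTriFamily G S F) :
    ∃ F' : ι → TriPath V, IsMinTriFamily G S F' := by
  classical
  have hex : ∃ n, ∃ F' : ι → TriPath V, IsTriFamily G S F' ∧ ∑ i, (F' i).inner.length = n :=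
    ⟨_, F, h, rfl⟩
  obtain ⟨F', hF', hn⟩ := Nat.find_spec hex
  exact ⟨F', hF', fun F'' h'' => hn ▸ Nat.find_min' hex ⟨F'', h'', rfl⟩⟩

variable [DecidableEq ι]

theorem length_le (h : IsMinTriFamily G S F) (hT : Equiv G S (F i) T) (hT' : Valid G S T')
    (hsub : ∀ v ∈ T'.inner, v ∈ T.inner)
    (hedge : ∀ e ∈ T'.edges, e ∈ T.edges ∨ ∀ j, e ∉ (F j).edges) :
    T.inner.length ≤ T'.inner.length := by
  have hi : ∀ v ∈ T'.inner, v ∈ (F i).inner := fun v hv => hT.perm.subset (hsub v hv)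
  rw [hT.edges] at hedge
  have key : IsTriFamily G S (Function.update F i T') := by
    refine ⟨fun a => ?_, fun a b hab => ?_, fun a b hab => ?_⟩
    · by_cases ha : a = i
      · simpa [ha] using hT'
      · simpa [ha] using h.1.valid a
    · have := h.1.disj a b hab
      by_cases ha : a = i <;> by_cases hb : b = i <;> simp_all [List.Disjoint] <;> grind
    · have := h.1.edges a b hab
      by_cases ha : a = i <;> by_cases hb : b = i <;>
        simp_all [Set.disjoint_left] <;> grind
  have hle := h.le _ key
  have hs : ∑ a ∈ Finset.univ.erase i, (Function.update F i T' a).inner.length =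
      ∑ a ∈ Finset.univ.erase i, (F a).inner.length :=
    Finset.sum_congr rfl fun a ha => by
      rw [Function.update_of_ne (Finset.ne_of_mem_erase ha)]
  rw [← Finset.add_sum_erase _ _ (Finset.mem_univ i),
    ← Finset.add_sum_erase _ (fun a => (Function.update F i T' a).inner.length)
      (Finset.mem_univ i), hs] at hle
  simp only [Function.update_self] at hle
  have := hT.perm.length_eq
  omega

theorem length_add_length_le (h : IsMinTriFamily G S F) (hij : i ≠ j)
    (hT₁ : Equiv G S (F i) T₁) (hT₂ : Equiv G S (F j) T₂)
    (hT₁' : Valid G S T₁') (hT₂' : Valid G S T₂')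
    (hsub₁ : ∀ v ∈ T₁'.inner, v ∈ T₁.inner ∨ v ∈ T₂.inner)
    (hsub₂ : ∀ v ∈ T₂'.inner, v ∈ T₁.inner ∨ v ∈ T₂.inner)
    (hdisj : T₁'.inner.Disjoint T₂'.inner)
    (hedge₁ : ∀ e ∈ T₁'.edges, e ∈ T₁.edges ∨ e ∈ T₂.edges)
    (hedge₂ : ∀ e ∈ T₂'.edges, e ∈ T₁.edges ∨ e ∈ T₂.edges)
    (hedge : Disjoint T₁'.edges T₂'.edges) :
    T₁.inner.length + T₂.inner.length ≤ T₁'.inner.length + T₂'.inner.length := by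
  rw [hT₁.edges, hT₂.edges] at hedge₁ hedge₂
  simp only [hT₁.perm.mem_iff, hT₂.perm.mem_iff] at hsub₁ hsub₂
  have key : IsTriFamily G S (Function.update (Function.update F i T₁') j T₂') := by
    refine ⟨fun a => ?_, fun a b hab => ?_, fun a b hab => ?_⟩
    · by_cases ha : a = j
      · simpa [ha] using hT₂'
      · by_cases ha' : a = i
        · simpa [ha', hij] using hT₁'
        · simpa [ha, ha'] using h.1.valid a
    · have h0 := h.1.disj a b hab
      have h1 := h.1.disj i a
      have h2 := h.1.disj i b
      have h3 := h.1.disj j a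
      have h4 := h.1.disj j b
      by_cases ha : a = j <;> by_cases hb : b = j <;> by_cases ha' : a = i <;>
        by_cases hb' : b = i <;> simp_all [List.Disjoint] <;> grind
    · have h0 := h.1.edges a b hab
      have h1 := h.1.edges i a
      have h2 := h.1.edges i b
      have h3 := h.1.edges j a
      have h4 := h.1.edges j b
      by_cases ha : a = j <;> by_cases hb : b = j <;> by_cases ha' : a = i <;>
        by_cases hb' : b = i <;> simp_all [Set.disjoint_left] <;> grind
  have hle := h.le _ key
  have hj : j ∈ Finset.univ.erase i := by simp [hij.symm]
  have hs : ∑ a ∈ (Finset.univ.erase i).erase j,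
        (Function.update (Function.update F i T₁') j T₂' a).inner.length =
      ∑ a ∈ (Finset.univ.erase i).erase j, (F a).inner.length :=
    Finset.sum_congr rfl fun a ha => by
      rw [Function.update_of_ne (Finset.ne_of_mem_erase ha),
        Function.update_of_ne (Finset.ne_of_mem_erase (Finset.mem_of_mem_erase ha))]
  rw [← Finset.add_sum_erase _ _ (Finset.mem_univ i), ← Finset.add_sum_erase _ _ hj,
    ← Finset.add_sum_erase _
      (fun a => (Function.update (Function.update F i T₁') j T₂' a).inner.length)
      (Finset.mem_univ i), ← Finset.add_sum_erase _
      (fun a => (Function.update (Function.update F i T₁') j T₂' a).inner.length) hj, hs] at hle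
  simp only [Function.update_self, Function.update_of_ne hij] at hle
  have := hT₁.perm.length_eq
  have := hT₂.perm.length_eq
  omega

end IsMinTriFamily

namespace IsMinTriFamily

variable {V ι : Type*} [DecidableEq V] [Fintype ι] [DecidableEq ι] {G : SimpleGraph V}
  {S : Finset V} {F : ι → TriPath V} {i j : ι} {p q s v b c : V} {A B C D A₁ A₂ B₁ B₂ : List V}

theorem eq_nil_of_adj_start (h : IsMinTriFamily G S F)
    (hT : Equiv G S (F i) ⟨p, q, s, A₁ ++ v :: A₂, B⟩) (hv : G.Adj p v) : A₁ = [] := by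
  have hV := hT.valid
  have hV' : Valid G S ⟨p, q, s, v :: A₂, B⟩ :=
    { hV with
      linkA := hV.linkA.drop hv
      disj := by have := hV.disj; intro w; have := @this w; simp_all }
  have := h.length_le hT hV' (by simp [TriPath.inner]; tauto) (by simp [TriPath.edges]; tauto)
  simpa [TriPath.inner] using this

theorem eq_nil_of_adj_mid (h : IsMinTriFamily G S F)
    (hT : Equiv G S (F i) ⟨p, q, s, A, B₁ ++ v :: B₂⟩) (hv : G.Adj q v) : B₁ = [] := by
  have hV := hT.valid
  have hV' : Valid G S ⟨p, q, s, A, v :: B₂⟩ :=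
    { hV with
      linkB := hV.linkB.drop hv
      disj := by have := hV.disj; intro w; have := @this w; simp_all }
  have := h.length_le hT hV' (by simp [TriPath.inner]; tauto) (by simp [TriPath.edges]; tauto)
  simpa [TriPath.inner] using this

theorem eq_nil_of_adj_far (h : IsMinTriFamily G S F)
    (hT : Equiv G S (F i) ⟨p, q, s, A, B₁ ++ v :: B₂⟩) (hv : G.Adj p v) : B₁ = [] := by
  have hV := hT.valid
  have hV' : Valid G S ⟨q, p, s, A.reverse, v :: B₂⟩ :=
    { am := hV.am.symm
      mb := hV.ab
      ab := hV.mb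
      terminals := by rw [hV.terminals]; ext w; simp; tauto
      linkA := hV.linkA.reverse
      linkB := hV.linkB.drop hv
      disj := by have := hV.disj; intro w; have := @this w; simp_all }
  have := h.length_le hT hV' (by simp [TriPath.inner]; tauto)
    (by simp [TriPath.edges, Sym2.eq_swap (a := q)]; tauto)
  simpa [TriPath.inner] using this

theorem eq_nil_of_adj_end (h : IsMinTriFamily G S F)
    (hT : Equiv G S (F i) ⟨p, q, s, A₁ ++ v :: A₂, B⟩) (hv : G.Adj q v ∨ G.Adj s v) :
    A₂ = [] := by
  have hT' := hT.reverse
  rw [List.reverse_append, List.reverse_cons, List.append_assoc] at hT'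
  rcases hv with hv | hv
  · simpa using h.eq_nil_of_adj_mid hT' hv
  · simpa using h.eq_nil_of_adj_far hT' hv

/-! ### Terminal edges -/

theorem not_adj_of_unused_left (h : IsMinTriFamily G S F)
    (hT : Equiv G S (F i) ⟨p, q, s, A, B⟩) (hun : ∀ j, s(p, q) ∉ (F j).edges) :
    ¬ G.Adj p q := by
  intro hpq
  have hV := hT.valid
  have hV' : Valid G S ⟨p, q, s, [], B⟩ :=
    { hV with
      linkA := .nil hpq
      disj := by simp }
  have := h.length_le hT hV' (by simp [TriPath.inner]; tauto) (by
    rintro e (⟨-, rfl⟩ | ⟨hB, rfl⟩)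
    exacts [.inr hun, .inl (.inr ⟨hB, rfl⟩)])
  have hA : A = [] := by
    simp [TriPath.inner] at this
    exact this
  exact hun i (by rw [← hT.edges]; simp [TriPath.edges, hA])

theorem eq_nil_of_unused_ends (h : IsMinTriFamily G S F)
    (hT : Equiv G S (F i) ⟨p, q, s, A, B⟩) (hun : ∀ j, s(p, s) ∉ (F j).edges)
    (hps : G.Adj p s) : A = [] := by
  have hV := hT.valid
  have hV' : Valid G S ⟨q, s, p, B, []⟩ :=
    { am := hV.mb
      mb := hV.ab.symm
      ab := hV.am.symm
      terminals := by rw [hV.terminals]; ext w; simp; tauto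
      linkA := hV.linkB
      linkB := .nil hps.symm
      disj := by simp }
  have := h.length_le hT hV' (by simp [TriPath.inner]; tauto)
    (by
      rintro e (⟨hB, rfl⟩ | ⟨-, rfl⟩)
      exacts [.inl (.inr ⟨hB, rfl⟩), .inr (by rwa [Sym2.eq_swap])])
  simpa [TriPath.inner] using this

/-- A minimal family of at least two paths uses every edge between terminals. -/
theorem exists_mem_edges (h : IsMinTriFamily G S F) (hij : i ≠ j)
    (hp : p ∈ S) (hq : q ∈ S) (hpq : G.Adj p q) : ∃ l, s(p, q) ∈ (F l).edges := by
  by_contra! hun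
  have key : ∀ l, s(p, q) = s((F l).a, (F l).b) ∧ (F l).A = [] ∧ (F l).B = [] := by
    intro l
    have hT := Equiv.rfl (h.1.valid l)
    have hne := hpq.ne
    have h1 : s(p, q) ≠ s((F l).a, (F l).m) := fun he =>
      h.not_adj_of_unused_left hT (by rwa [← he]) (by
        rwa [← G.mem_edgeSet, ← he, G.mem_edgeSet])
    have h2 : s(p, q) ≠ s((F l).b, (F l).m) := fun he =>
      h.not_adj_of_unused_left hT.reverse (by rwa [← he]) (by
        rwa [← G.mem_edgeSet, ← he, G.mem_edgeSet])
    have h3 : s(p, q) = s((F l).a, (F l).b) := by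
      rw [(h.1.valid l).terminals] at hp hq
      simp at hp hq
      grind
    have hadj : G.Adj (F l).a (F l).b := by rwa [← G.mem_edgeSet, ← h3, G.mem_edgeSet]
    refine ⟨h3, h.eq_nil_of_unused_ends hT (by rwa [← h3]) hadj, ?_⟩
    have := h.eq_nil_of_unused_ends hT.reverse (by rwa [Sym2.eq_swap, ← h3]) hadj.symm
    simpa using this
  obtain ⟨hi, hiA, hiB⟩ := key i
  obtain ⟨hj, hjA, hjB⟩ := key j
  have hd : s((F i).a, (F i).m) ∉ (F j).edges := Set.disjoint_left.1 (h.1.edges i j hij)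
    (by simp [TriPath.edges, hiA])
  apply hd
  have h1 := (h.1.valid i).terminals
  have := (h.1.valid i).am
  have := (h.1.valid i).mb
  have h2 := (h.1.valid j).terminals
  have hm : (F i).m ∈ S := by simp [h1]
  rw [h2] at hm
  rw [hi, Sym2.eq_iff] at hj
  simp [TriPath.edges, hjA, hjB] at hm ⊢
  clear hi key hun h1 h2 hd hp hq
  grind

/-! ### Lollipops: paths whose initial part ends in a vertex adjacent to both other terminals -/

theorem not_adj_of_lollipop_self (h : IsMinTriFamily G S F)
    (hT : Equiv G S (F i) ⟨p, q, s, A ++ [b], C⟩) (hA : A ≠ []) (hb : G.Adj b s)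
    (hc : c ∈ C) : ¬ G.Adj p c := by
  intro hpc
  obtain ⟨C₁, C₂, rfl⟩ := List.append_of_mem hc
  obtain rfl := h.eq_nil_of_adj_far hT hpc
  have hV := hT.valid
  have hcb : c ≠ b := by have := @hV.disj c; simp at this; tauto
  have hV' : Valid G S ⟨p, q, s, [c], [b]⟩ :=
    { hV with
      linkA := .single hpc hV.linkB.adj_head.symm (hV.linkB.off c (by simp))
      linkB := .single hV.linkA.adj_last.symm hb (hV.linkA.off b (by simp))
      disj := by simpa using hcb.symm }
  have := h.length_le hT hV' (by simp [TriPath.inner]) (by simp [TriPath.edges])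
  have := List.length_pos_iff.2 hA
  simp [TriPath.inner] at *
  omega

theorem false_of_lollipop_of_mid (h : IsMinTriFamily G S F)
    (hT : Equiv G S (F i) ⟨p, q, s, A ++ [b], C⟩) (hA : A ≠ []) (hb : G.Adj b s)
    (hij : i ≠ j) (hT' : Equiv G S (F j) ⟨q, p, s, B, D⟩) :
    False := by
  have hV := hT.valid
  have hV' := hT'.valid
  have hd := h.1.disj i j hij
  have hd' : ∀ v, v ∈ A ∨ v = b ∨ v ∈ C → v ∈ B ∨ v ∈ D → False := by
    intro v h1 h2
    refine @hd v (hT.perm.subset ?_) (hT'.perm.subset ?_) <;> simp [TriPath.inner] <;> tauto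
  have hV₁ : Valid G S ⟨p, q, s, B.reverse, [b]⟩ :=
    { hV with
      linkA := hV'.linkA.reverse
      linkB := .single hV.linkA.adj_last.symm hb (hV.linkA.off b (by simp))
      disj := by simp; exact fun hbB => hd' b (by simp) (.inl hbB) }
  have hV₂ : Valid G S ⟨p, s, q, D, C.reverse⟩ :=
    { am := hV.ab
      mb := hV.mb.symm
      ab := hV.am
      terminals := by rw [hV.terminals]; ext w; simp; tauto
      linkA := hV'.linkB
      linkB := hV.linkB.reverse
      disj := fun v h1 h2 => hd' v (by simp_all) (.inr h1) }
  have := h.length_add_length_le hij hT hT' hV₁ hV₂ (by simp [TriPath.inner]; tauto)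
    (by simp [TriPath.inner]; tauto)
    (by
      intro v h1 h2
      have h3 := @hV'.disj v
      have h4 := @hV.disj v
      have h5 := hd' v
      simp [TriPath.inner] at *
      grind)
    (by simp [TriPath.edges, Sym2.eq_swap (a := q)]; tauto)
    (by simp [TriPath.edges, Sym2.eq_swap (a := s)]; tauto)
    (by
      have := hV.am
      have := hV.mb
      have := hV.ab
      rw [Set.disjoint_left]
      simp [TriPath.edges]
      grind)
  have := List.length_pos_iff.2 hA
  simp [TriPath.inner] at *
  omega

theorem not_adj_of_lollipop_end (h : IsMinTriFamily G S F)
    (hT : Equiv G S (F i) ⟨p, q, s, A ++ [b], C⟩) (hA : A ≠ []) (hb : G.Adj b s)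
    (hij : i ≠ j) (hT' : Equiv G S (F j) ⟨p, q, s, B, D⟩)
    (hc : c ∈ D) : ¬ G.Adj p c := by
  intro hpc
  obtain ⟨D₁, D₂, rfl⟩ := List.append_of_mem hc
  obtain rfl := h.eq_nil_of_adj_far hT' hpc
  have hV := hT.valid
  have hV' := hT'.valid
  have hd := h.1.disj i j hij
  have hd' : ∀ v, v ∈ A ∨ v = b ∨ v ∈ C → v ∈ B ∨ v = c ∨ v ∈ D₂ → False := by
    intro v h1 h2
    refine @hd v (hT.perm.subset ?_) (hT'.perm.subset ?_) <;> simp [TriPath.inner] <;> tauto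
  have hV₁ : Valid G S ⟨p, q, s, [c], [b]⟩ :=
    { hV with
      linkA := .single hpc hV'.linkB.adj_head.symm (hV'.linkB.off c (by simp))
      linkB := .single hV.linkA.adj_last.symm hb (hV.linkA.off b (by simp))
      disj := by simp; rintro rfl; exact hd' b (by simp) (by simp) }
  have hV₂ : Valid G S ⟨p, q, s, B, C⟩ :=
    { hV with
      linkA := hV'.linkA
      linkB := hV.linkB
      disj := fun v h1 h2 => hd' v (by simp_all) (.inl h1) }
  have := h.length_add_length_le hij hT hT' hV₁ hV₂ (by simp [TriPath.inner])
    (by simp [TriPath.inner]; tauto)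
    (by
      intro v h1 h2
      have h3 := @hV'.disj v
      have h4 := @hV.disj v
      have h5 := hd' v
      simp [TriPath.inner] at *
      grind)
    (by simp [TriPath.edges])
    (by simp [TriPath.edges]; tauto)
    (by
      rw [Set.disjoint_left]
      simp [TriPath.edges])
  have := List.length_pos_iff.2 hA
  simp [TriPath.inner] at *
  omega

/-- In the presence of a lollipop starting at `p`, every path of the family starts at `p` and
has no further neighbour of `p` beyond its first part. -/
theorem exists_equiv_of_lollipop (h : IsMinTriFamily G S F)
    (hT : Equiv G S (F i) ⟨p, q, s, A ++ [b], C⟩) (hA : A ≠ []) (hb : G.Adj b s)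
    (j : ι) :
    ∃ m e B D, Equiv G S (F j) ⟨p, m, e, B, D⟩ ∧ ∀ c ∈ D, ¬ G.Adj p c := by
  by_cases hij : i = j
  · exact hij ▸ ⟨q, s, _, C, hT, fun c hc => h.not_adj_of_lollipop_self hT hA hb hc⟩
  have hrot := hT.rotate hb
  have hb' : G.Adj b q := hT.valid.linkA.adj_last
  have main : ∀ a m e B D, Equiv G S (F j) ⟨a, m, e, B, D⟩ → p = a →
      ∃ m e B D, Equiv G S (F j) ⟨p, m, e, B, D⟩ ∧ ∀ c ∈ D, ¬ G.Adj p c := by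
    rintro a m e B D hj rfl
    refine ⟨m, e, B, D, hj, fun c hc => ?_⟩
    have hme : (m = q ∧ e = s) ∨ (m = s ∧ e = q) := by
      have h1 := hT.valid
      have h2 := hj.valid
      have ht := h1.terminals.symm.trans h2.terminals
      have hm : m ∈ ({p, q, s} : Finset V) := by simp [ht]
      have he : e ∈ ({p, q, s} : Finset V) := by simp [ht]
      have := h2.am
      have := h2.mb
      have := h2.ab
      simp at hm he
      grind
    rcases hme with ⟨rfl, rfl⟩ | ⟨rfl, rfl⟩
    · exact h.not_adj_of_lollipop_end hT hA hb hij hj hc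
    · exact h.not_adj_of_lollipop_end hrot hA hb' hij hj hc
  have hj := Equiv.rfl (h.1.valid j)
  have hp : p = (F j).a ∨ p = (F j).m ∨ p = (F j).b := by
    have : p ∈ S := by simp [hT.valid.terminals]
    rw [(h.1.valid j).terminals] at this
    simpa using this
  rcases hp with hp | hp | hp
  · exact main _ _ _ _ _ hj hp
  · exfalso
    have hae : ((F j).a = q ∧ (F j).b = s) ∨ ((F j).a = s ∧ (F j).b = q) := by
      have h1 := hT.valid
      have h2 := hj.valid
      have ht := h1.terminals.symm.trans h2.terminals
      have hm : (F j).a ∈ ({p, q, s} : Finset V) := by simp [ht]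
      have he : (F j).b ∈ ({p, q, s} : Finset V) := by simp [ht]
      have := h2.am
      have := h2.mb
      have := h2.ab
      simp at hm he
      grind
    rcases hae with ⟨ha, he⟩ | ⟨ha, he⟩
    · exact h.false_of_lollipop_of_mid hT hA hb hij (by rw [← ha, ← he, hp]; exact hj)
    · exact h.false_of_lollipop_of_mid hT hA hb hij (by rw [← ha, ← he, hp]; exact hj.reverse)
  · exact main _ _ _ _ _ hj.reverse hp

end IsMinTriFamily

open Classical in
/-- The number of terminals adjacent to `v`. -/
noncomputable def SimpleGraph.terminalDegree {V : Type*} (G : SimpleGraph V) (S : Finset V)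
    (v : V) : ℕ :=
  (S.filter fun p => G.Adj p v).card

open Classical in
/-- The number of terminals joined to `p` by an edge of the path. -/
noncomputable def TriPath.edgeDegree {V : Type*} (S : Finset V) (T : TriPath V) (p : V) : ℕ :=
  (S.filter fun q => s(p, q) ∈ T.edges).card

section TerminalDegree

variable {V : Type*} [DecidableEq V] {G : SimpleGraph V} {S : Finset V} {p q s v : V}

theorem terminalDegree_le_one (hS : S = {p, q, s}) (hp : ¬ G.Adj p v) (hq : ¬ G.Adj q v) :
    G.terminalDegree S v ≤ 1 := by
  classical
  refine (Finset.card_le_card (t := {s}) fun w hw => ?_).trans (Finset.card_singleton s).le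
  simp [hS] at hw ⊢
  grind

theorem terminalDegree_eq_zero (hS : S = {p, q, s}) (hp : ¬ G.Adj p v) (hq : ¬ G.Adj q v)
    (hs : ¬ G.Adj s v) : G.terminalDegree S v = 0 := by
  classical
  simp [terminalDegree, hS, hp, hq, hs]

theorem TriPath.Valid.sum_edgeDegree_le {T : TriPath V} (h : Valid G S T) :
    ∑ p ∈ S, T.edgeDegree S p ≤ (if T.A = [] then 2 else 0) + if T.B = [] then 2 else 0 := by
  classical
  obtain ⟨a, m, b, A, B⟩ := T
  have := h.am
  have := h.mb
  have := h.ab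
  have h1 : edgeDegree S ⟨a, m, b, A, B⟩ a ≤ if A = [] then 1 else 0 := by
    refine (Finset.card_le_card (t := if A = [] then {m} else ∅) fun w hw => ?_).trans ?_
    · simp [TriPath.edges] at hw
      split_ifs <;> grind
    · split_ifs <;> simp
  have h2 : edgeDegree S ⟨a, m, b, A, B⟩ b ≤ if B = [] then 1 else 0 := by
    refine (Finset.card_le_card (t := if B = [] then {m} else ∅) fun w hw => ?_).trans ?_
    · simp [TriPath.edges] at hw
      split_ifs <;> grind
    · split_ifs <;> simp
  have h3 : edgeDegree S ⟨a, m, b, A, B⟩ m ≤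
      (if A = [] then 1 else 0) + if B = [] then 1 else 0 := by
    refine (Finset.card_le_card
      (t := (if A = [] then {a} else ∅) ∪ if B = [] then {b} else ∅) fun w hw => ?_).trans
      ((Finset.card_union_le _ _).trans (Nat.add_le_add ?_ ?_))
    · simp [TriPath.edges] at hw
      split_ifs <;> grind
    · split_ifs <;> simp
    · split_ifs <;> simp
  have hsum : ∑ p ∈ S, edgeDegree S ⟨a, m, b, A, B⟩ p = edgeDegree S ⟨a, m, b, A, B⟩ a +
      (edgeDegree S ⟨a, m, b, A, B⟩ m + edgeDegree S ⟨a, m, b, A, B⟩ b) := by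
    nth_rewrite 1 [h.terminals]
    rw [Finset.sum_insert (by simp; tauto), Finset.sum_insert (by simp; tauto),
      Finset.sum_singleton]
  rw [hsum]
  dsimp only
  split_ifs at * <;> omega

end TerminalDegree

namespace IsMinTriFamily

variable {V ι : Type*} [DecidableEq V] [Fintype ι] [DecidableEq ι] {G : SimpleGraph V}
  {S : Finset V} {F : ι → TriPath V} {i j : ι} {p q s v b c : V} {A B C D : List V} {k r : ℕ}

theorem sum_terminalDegree_left_le (h : IsMinTriFamily G S F)
    (hT : Equiv G S (F i) ⟨p, q, s, A, B⟩)
    (hA : ∀ A' b, A = A' ++ [b] → A' ≠ [] → ¬ G.Adj b s) :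
    (A.map fun v => min 2 (G.terminalDegree S v)).sum + (if A = [] then 2 else 0) ≤ 2 := by
  have hS := hT.valid.terminals
  dsimp only at hS
  have hS' : S = {q, s, p} := by rw [hS]; ext; simp; tauto
  have hS'' : S = {p, s, q} := by rw [hS]; ext; simp; tauto
  rcases A with - | ⟨a, A⟩
  · simp
  rcases List.eq_nil_or_concat' A with rfl | ⟨M, b, rfl⟩
  · simp
  have ha : G.terminalDegree S a ≤ 1 := by
    have key : ¬ (G.Adj q a ∨ G.Adj s a) := fun hadj => by
      simpa using h.eq_nil_of_adj_end (A₁ := []) hT hadj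
    exact terminalDegree_le_one hS' (by tauto) (by tauto)
  have hb : G.terminalDegree S b ≤ 1 := by
    refine terminalDegree_le_one hS'' (fun hadj => ?_) (fun hadj => ?_)
    · simpa using h.eq_nil_of_adj_start (A₁ := a :: M) (A₂ := []) hT hadj
    · exact hA (a :: M) b (by simp) (by simp) hadj.symm
  have hM : (M.map fun v => min 2 (G.terminalDegree S v)).sum = 0 := by
    refine List.sum_eq_zero fun n hn => ?_
    obtain ⟨v, hv, rfl⟩ := List.mem_map.1 hn
    obtain ⟨M₁, M₂, rfl⟩ := List.append_of_mem hv
    have hT' : Equiv G S (F i) ⟨p, q, s, (a :: M₁) ++ v :: (M₂ ++ [b]), B⟩ := by simpa using hT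
    have key : ¬ (G.Adj q v ∨ G.Adj s v) := fun hadj => by
      simpa using h.eq_nil_of_adj_end hT' hadj
    have key' : ¬ G.Adj p v := fun hadj => by
      simpa using h.eq_nil_of_adj_start hT' hadj
    simp [terminalDegree_eq_zero hS key' (by tauto) (by tauto)]
  simp only [List.map_cons, List.map_append, List.sum_cons, List.sum_append, hM]
  simp
  omega

/-- A path that is not a lollipop uses up at most four units. -/
theorem sum_terminalDegree_add_edgeDegree_le (h : IsMinTriFamily G S F)
    (hno : ∀ p q s A b C, Equiv G S (F i) ⟨p, q, s, A ++ [b], C⟩ → A ≠ [] → ¬ G.Adj b s) :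
    ∑ v ∈ (F i).inner.toFinset, min 2 (G.terminalDegree S v) +
      ∑ p ∈ S, (F i).edgeDegree S p ≤ 4 := by
  have hT := Equiv.rfl (h.1.valid i)
  have h1 := h.sum_terminalDegree_left_le hT
    (fun A' b hA' => hno _ _ _ A' b _ (by rw [← hA']; exact hT))
  have h2 := h.sum_terminalDegree_left_le hT.reverse
    (fun A' b hA' => hno _ _ _ A' b _ (by rw [← hA']; exact hT.reverse))
  have h3 := (h.1.valid i).sum_edgeDegree_le
  rw [List.sum_toFinset _ (h.1.valid i).nodup_inner]
  simp only [TriPath.inner, List.map_append, List.sum_append, List.map_reverse, List.sum_reverse,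
    List.reverse_eq_nil_iff] at *
  omega

theorem card_inter_le (h : IsMinTriFamily G S F) (hij : i ≠ j) {nb : V → Finset V}
    (hnb : ∀ p v, v ∈ nb p ↔ G.Adj p v) (hp : p ∈ S) : (nb p ∩ S).card ≤ ∑ l, (F l).edgeDegree S p := by
  classical
  refine (Finset.card_le_card (t := Finset.univ.biUnion fun l =>
    S.filter fun q => s(p, q) ∈ (F l).edges) fun q hq => ?_).trans Finset.card_biUnion_le
  rw [Finset.mem_inter, hnb] at hq
  obtain ⟨l, hl⟩ := h.exists_mem_edges hij hp hq.2 hq.1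
  simp only [Finset.mem_biUnion, Finset.mem_filter, Finset.mem_univ, true_and]
  exact ⟨l, hq.2, hl⟩

theorem one_lt_card_of_not_lollipop (h : IsMinTriFamily G S F) (hij : i ≠ j) {nb : V → Finset V}
    (hnb : ∀ p v, v ∈ nb p ↔ G.Adj p v) (hcard : ∀ p, (nb p).card = k)

    (hno : ∀ i p q s A b C, Equiv G S (F i) ⟨p, q, s, A ++ [b], C⟩ → A ≠ [] → ¬ G.Adj b s)
    (hr : ∀ R : Finset V, (∀ v ∈ R, ∀ p ∈ S, G.Adj p v) → R.card ≤ r)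
    (hS : S.card = 3) (hineq : 4 * Fintype.card ι + r + 3 ≤ 3 * k) :
    1 < (((S.biUnion nb) \ S) \ Finset.univ.biUnion fun l => (F l).inner.toFinset).card := by
  classical
  set N := (S.biUnion nb) \ S with hN
  set U := Finset.univ.biUnion fun l => (F l).inner.toFinset with hU
  have h1 : ∑ v ∈ U, min 2 (G.terminalDegree S v) + ∑ p ∈ S, (nb p ∩ S).card ≤
      4 * Fintype.card ι := by
    calc _ ≤ ∑ l, ∑ v ∈ (F l).inner.toFinset, min 2 (G.terminalDegree S v) +
          ∑ p ∈ S, ∑ l, (F l).edgeDegree S p := by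
          refine Nat.add_le_add (le_of_eq (Finset.sum_biUnion fun a _ b _ hab => ?_))
            (Finset.sum_le_sum fun p hp => h.card_inter_le hij hnb hp)
          rw [Function.onFun, Finset.disjoint_left]
          intro v hva hvb
          exact h.1.disj a b hab (List.mem_toFinset.1 hva) (List.mem_toFinset.1 hvb)
      _ = ∑ l, (∑ v ∈ (F l).inner.toFinset, min 2 (G.terminalDegree S v) +
          ∑ p ∈ S, (F l).edgeDegree S p) := by
          rw [Finset.sum_comm (s := S), Finset.sum_add_distrib]
      _ ≤ ∑ l : ι, 4 := Finset.sum_le_sum fun l _ =>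
          h.sum_terminalDegree_add_edgeDegree_le (hno l)
      _ = 4 * Fintype.card ι := by simp [mul_comm]
  have h2 : ∑ p ∈ S, (nb p \ S).card = ∑ v ∈ N, G.terminalDegree S v := by
    have := Finset.sum_card_bipartiteAbove_eq_sum_card_bipartiteBelow G.Adj (s := S) (t := N)
    refine Eq.trans (Finset.sum_congr rfl fun p hp => congrArg _ ?_) this
    ext v
    simp only [hN, Finset.mem_sdiff, Finset.bipartiteAbove, Finset.mem_filter,
      Finset.mem_biUnion, hnb]
    exact ⟨fun hv => ⟨⟨⟨p, hp, hv.1⟩, hv.2⟩, hv.1⟩, fun hv => ⟨hv.2, hv.1.2⟩⟩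
  have h3 : ∑ p ∈ S, (nb p \ S).card + ∑ p ∈ S, (nb p ∩ S).card = 3 * k := by
    rw [← Finset.sum_add_distrib]
    simp [Finset.card_sdiff_add_card_inter, hcard, hS]
  have h4 : ∑ v ∈ N, G.terminalDegree S v ≤ ∑ v ∈ N, min 2 (G.terminalDegree S v) + r := by
    refine le_trans ?_ (Nat.add_le_add_left
      (hr (N.filter fun v => ∀ p ∈ S, G.Adj p v) fun v hv => (Finset.mem_filter.1 hv).2) _)
    rw [Finset.card_filter, ← Finset.sum_add_distrib]
    refine Finset.sum_le_sum fun v _ => ?_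
    have hle : G.terminalDegree S v ≤ 3 := hS ▸ Finset.card_filter_le _ _
    split_ifs with hall
    · omega
    · have : G.terminalDegree S v ≠ 3 := fun he => hall fun p hp => by
        have := Finset.eq_of_subset_of_card_le (Finset.filter_subset (fun p => G.Adj p v) S)
          (by rw [hS, ← he]; rfl)
        rw [← this] at hp
        exact (Finset.mem_filter.1 hp).2
      omega
  have h5 : ∑ v ∈ N, min 2 (G.terminalDegree S v) ≤
      ∑ v ∈ N \ U, min 2 (G.terminalDegree S v) + ∑ v ∈ U, min 2 (G.terminalDegree S v) := by
    rw [← Finset.sum_union Finset.sdiff_disjoint, Finset.sdiff_union_self_eq_union]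
    exact Finset.sum_le_sum_of_subset Finset.subset_union_left
  have h6 : ∑ v ∈ N \ U, min 2 (G.terminalDegree S v) ≤ 2 * (N \ U).card := by
    refine (Finset.sum_le_card_nsmul _ _ 2 fun v _ => min_le_left _ _).trans ?_
    simp [mul_comm]
  omega

theorem one_lt_card_of_lollipop (h : IsMinTriFamily G S F) (hij : i ≠ j) {nb : V → Finset V}
    (hnb : ∀ p v, v ∈ nb p ↔ G.Adj p v) (hcard : ∀ p, (nb p).card = k)
    {i : ι} (hT : Equiv G S (F i) ⟨p, q, s, A ++ [b], C⟩)
    (hA : A ≠ []) (hb : G.Adj b s) (hk : Fintype.card ι + 2 ≤ k) :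
    1 < ((nb p \ S) \ Finset.univ.biUnion fun l => (F l).inner.toFinset).card := by
  classical
  set U := Finset.univ.biUnion fun l => (F l).inner.toFinset with hU
  have hp : p ∈ S := by simp [hT.valid.terminals]
  let g : ι → Finset V := fun l =>
    (nb p).filter (· ∈ (F l).inner) ∪ S.filter fun t => s(p, t) ∈ (F l).edges
  have hg : ∀ l, (g l).card ≤ 1 := by
    intro l
    obtain ⟨m, e, B, D, hl, hD⟩ := h.exists_equiv_of_lollipop hT hA hb l
    have hV := hl.valid
    have := hV.am
    have := hV.ab
    refine (Finset.card_le_card (t := {(B ++ [m]).head (by simp)}) fun w hw => ?_).trans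
      (Finset.card_singleton _).le
    simp only [g, Finset.mem_union, Finset.mem_filter, hnb, ← hl.edges, ← hl.perm.mem_iff] at hw
    simp only [TriPath.inner, List.mem_append] at hw
    rw [Finset.mem_singleton]
    rcases hw with ⟨hpw, hw | hw⟩ | ⟨-, hw⟩
    · obtain ⟨B₁, B₂, rfl⟩ := List.append_of_mem hw
      obtain rfl := h.eq_nil_of_adj_start hl hpw
      simp
    · exact absurd hpw (hD w hw)
    · simp [TriPath.edges] at hw
      grind
  have hsub : nb p ⊆ ((nb p \ S) \ U) ∪ Finset.univ.biUnion g := by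
    intro w hw
    by_cases hwS : w ∈ S
    · obtain ⟨l, hl⟩ := h.exists_mem_edges hij hp hwS ((hnb p w).1 hw)
      exact Finset.mem_union_right _ (Finset.mem_biUnion.2 ⟨l, Finset.mem_univ _,
        Finset.mem_union_right _ (Finset.mem_filter.2 ⟨hwS, hl⟩)⟩)
    by_cases hwU : w ∈ U
    · obtain ⟨l, -, hl⟩ := Finset.mem_biUnion.1 hwU
      exact Finset.mem_union_right _ (Finset.mem_biUnion.2 ⟨l, Finset.mem_univ _,
        Finset.mem_union_left _ (Finset.mem_filter.2 ⟨hw, List.mem_toFinset.1 hl⟩)⟩)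
    · simp [hw, hwS, hwU]
  have h1 := (Finset.card_le_card hsub).trans (Finset.card_union_le _ _)
  have h2 : (Finset.univ.biUnion g).card ≤ Fintype.card ι := by
    simpa using Finset.card_biUnion_le_card_mul Finset.univ g 1 fun l _ => hg l
  rw [hcard] at h1
  omega

/-- A minimal family leaves out two vertices adjacent to the terminals. -/
theorem exists_unused_pair (h : IsMinTriFamily G S F) (hij : i ≠ j) {nb : V → Finset V}
    (hnb : ∀ p v, v ∈ nb p ↔ G.Adj p v) (hcard : ∀ p, (nb p).card = k)

    (hr : ∀ R : Finset V, (∀ v ∈ R, ∀ p ∈ S, G.Adj p v) → R.card ≤ r)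
    (hS : S.card = 3) (hineq : 4 * Fintype.card ι + r + 3 ≤ 3 * k) :
    ∃ u v, u ≠ v ∧ ∀ w, w = u ∨ w = v →
      w ∉ S ∧ (∃ p ∈ S, G.Adj p w) ∧ ∀ l, w ∉ (F l).inner := by
  have hι : 1 < Fintype.card ι := Fintype.one_lt_card_iff.2 ⟨i, j, hij⟩
  suffices hX : ∃ X : Finset V, 1 < X.card ∧
      ∀ w ∈ X, w ∉ S ∧ (∃ p ∈ S, G.Adj p w) ∧ ∀ l, w ∉ (F l).inner by
    obtain ⟨X, hX, hX'⟩ := hX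
    obtain ⟨u, hu, v, hv, huv⟩ := Finset.one_lt_card.1 hX
    refine ⟨u, v, huv, ?_⟩
    rintro w (rfl | rfl)
    exacts [hX' _ hu, hX' _ hv]
  by_cases hno : ∀ i p q s A b C, Equiv G S (F i) ⟨p, q, s, A ++ [b], C⟩ → A ≠ [] →
      ¬ G.Adj b s
  · refine ⟨_, h.one_lt_card_of_not_lollipop hij hnb hcard hno hr hS hineq, fun w hw => ?_⟩
    simp only [Finset.mem_sdiff, Finset.mem_biUnion, hnb, Finset.mem_univ, true_and,
      List.mem_toFinset, not_exists] at hw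
    exact ⟨hw.1.2, hw.1.1, hw.2⟩
  · push Not at hno
    obtain ⟨l, p, q, s, A, b, C, hT, hA, hb⟩ := hno
    refine ⟨_, h.one_lt_card_of_lollipop hij hnb hcard hT hA hb (by omega), fun w hw => ?_⟩
    simp only [Finset.mem_sdiff, Finset.mem_biUnion, hnb, Finset.mem_univ, true_and,
      List.mem_toFinset, not_exists] at hw
    exact ⟨hw.1.2, ⟨p, by simp [hT.valid.terminals], hw.1.1⟩, hw.2⟩

end IsMinTriFamily

section Conversion

variable {V : Type*} [DecidableEq V] {G : SimpleGraph V} {S : Finset V} {x y z : V}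

theorem List.exists_eq_append_three {L : List V} (hx : x ∈ L) (hy : y ∈ L) (hz : z ∈ L)
    (hxy : x ≠ y) (hxz : x ≠ z) (hyz : y ≠ z) :
    ∃ p q s L₁ A B L₂, L = L₁ ++ p :: (A ++ q :: (B ++ s :: L₂)) ∧
      ({x, y, z} : Finset V) = {p, q, s} := by
  obtain ⟨L₁, L₂, rfl⟩ := List.append_of_mem hx
  have hy' : y ∈ L₁ ∨ y ∈ L₂ := by simp at hy; tauto
  have hz' : z ∈ L₁ ∨ z ∈ L₂ := by simp at hz; tauto
  rcases hy' with hy' | hy'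
  · obtain ⟨M₁, M₂, rfl⟩ := List.append_of_mem hy'
    rcases hz' with hz' | hz'
    · have hz'' : z ∈ M₁ ∨ z ∈ M₂ := by simp at hz'; tauto
      rcases hz'' with hz'' | hz''
      · obtain ⟨N₁, N₂, rfl⟩ := List.append_of_mem hz''
        exact ⟨z, y, x, N₁, N₂, M₂, L₂, by simp, by ext; simp; tauto⟩
      · obtain ⟨N₁, N₂, rfl⟩ := List.append_of_mem hz''
        exact ⟨y, z, x, M₁, N₁, N₂, L₂, by simp, by ext; simp; tauto⟩
    · obtain ⟨N₁, N₂, rfl⟩ := List.append_of_mem hz'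
      exact ⟨y, x, z, M₁, M₂, N₁, N₂, by simp, by ext; simp; tauto⟩
  · obtain ⟨M₁, M₂, rfl⟩ := List.append_of_mem hy'
    rcases hz' with hz' | hz'
    · obtain ⟨N₁, N₂, rfl⟩ := List.append_of_mem hz'
      exact ⟨z, x, y, N₁, N₂, M₁, M₂, by simp, by ext; simp; tauto⟩
    · have hz'' : z ∈ M₁ ∨ z ∈ M₂ := by simp at hz'; tauto
      rcases hz'' with hz'' | hz''
      · obtain ⟨N₁, N₂, rfl⟩ := List.append_of_mem hz''
        exact ⟨x, z, y, L₁, N₁, N₂, M₂, by simp, by ext; simp; tauto⟩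
      · obtain ⟨N₁, N₂, rfl⟩ := List.append_of_mem hz''
        exact ⟨x, y, z, L₁, M₁, N₁, N₂, by simp, rfl⟩

theorem SteinerPath.exists_triPath (P : SteinerPath G {x, y, z})
    (hxy : x ≠ y) (hxz : x ≠ z) (hyz : y ≠ z) :
    ∃ T : TriPath V, Valid G {x, y, z} T ∧ (∀ v ∈ T.inner, v ∈ P.walk.support) ∧
      ∀ e ∈ T.edges, e ∈ P.walk.edges := by
  obtain ⟨p, q, s, L₁, A, B, L₂, hL, hS⟩ := List.exists_eq_append_three
    (P.contains x (by simp)) (P.contains y (by simp)) (P.contains z (by simp)) hxy hxz hyz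
  have hnd := P.isPath.support_nodup
  have hch := P.walk.isChain_adj_support
  rw [hL] at hnd hch
  have hch' := (List.isChain_append.1 hch).2.1
  have e1 : p :: (A ++ q :: (B ++ s :: L₂)) = (p :: (A ++ [q])) ++ (B ++ s :: L₂) := by simp
  have e2 : p :: (A ++ q :: (B ++ s :: L₂)) = (p :: A) ++ ((q :: (B ++ [s])) ++ L₂) := by simp
  have c1 : (p :: (A ++ [q])).IsChain G.Adj := by
    rw [e1] at hch'
    exact (List.isChain_append.1 hch').1
  have c2 : (q :: (B ++ [s])).IsChain G.Adj := by
    rw [e2] at hch'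
    exact (List.isChain_append.1 (List.isChain_append.1 hch').2.1).1
  have hnd' := (List.nodup_append'.1 hnd).2.1
  simp only [List.nodup_cons, List.nodup_append', List.mem_append, List.mem_cons] at hnd'
  refine ⟨⟨p, q, s, A, B⟩, ⟨?_, ?_, ?_, hS, ⟨c1, ?_, ?_⟩, ⟨c2, ?_, ?_⟩, ?_⟩, ?_, ?_⟩
  · grind
  · grind
  · grind
  · exact hnd'.2.1
  · intro v hv
    have := @hnd'.2.2.2 v hv
    simp at this
    rw [hS]
    simp
    grind
  · grind
  · intro v hv
    have h1 := @hnd'.2.2.2 v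
    have h2 := @hnd'.2.2.1.2.2.2 v hv
    simp at h1 h2
    rw [hS]
    simp
    grind
  · intro v hv hvB
    have := @hnd'.2.2.2 v hv
    simp at this
    tauto
  · intro v hv
    rw [hL]
    simp [TriPath.inner] at hv ⊢
    tauto
  · rintro e (⟨h, rfl⟩ | ⟨h, rfl⟩) <;> rw [← Walk.infix_support_iff_mem_edges, hL] <;>
      dsimp only at h <;> subst h
    · exact Or.inl ⟨L₁, B ++ s :: L₂, by simp⟩
    · exact Or.inl ⟨L₁ ++ p :: A, L₂, by simp⟩

theorem TriPath.Valid.exists_steinerPath {T : TriPath V} (h : Valid G S T) :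
    ∃ P : SteinerPath G (S : Set V), (∀ v ∈ P.walk.support, v ∈ S ∨ v ∈ T.inner) ∧
      ∀ e ∈ P.walk.edges, e ∈ T.edges ∨ ∃ v ∈ T.inner, v ∈ e := by
  obtain ⟨p, q, s, A, B⟩ := T
  obtain ⟨w₁, hs₁, he₁⟩ := IsLink.exists_walk h.linkA.chain
  obtain ⟨w₂, hs₂, he₂⟩ := IsLink.exists_walk h.linkB.chain
  have hsupp : (w₁.append w₂).support = p :: (A ++ q :: (B ++ [s])) := by
    rw [Walk.support_append, hs₁, hs₂]
    simp
  have hS := h.terminals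
  dsimp only at hS
  refine ⟨⟨p, s, w₁.append w₂, .mk' ?_, ?_⟩, ?_, ?_⟩
  · have hA := h.linkA.off
    have hB := h.linkB.off
    have hpq := h.am
    have hqs := h.mb
    have hps := h.ab
    simp only [hS] at hA hB
    rw [hsupp]
    simp only [List.nodup_cons, List.nodup_append', List.mem_append, List.mem_cons,
      List.disjoint_cons_right, List.disjoint_append_right]
    have := h.linkA.nodup
    have := h.linkB.nodup
    have := h.disj
    simp
    grind
  · intro v hv
    rw [hsupp]
    simp [hS] at hv ⊢
    tauto
  · intro v hv
    dsimp only at hv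
    rw [hsupp] at hv
    simp [TriPath.inner, hS] at hv ⊢
    tauto
  · intro e he
    rw [Walk.edges_append, List.mem_append] at he
    simp only [TriPath.inner, TriPath.edges, List.mem_append, Set.mem_ofPred_eq]
    rcases he with he | he
    · rcases he₁ e he with h' | ⟨v, hv, hve⟩
      · exact .inl (.inl h')
      · exact .inr ⟨v, .inl hv, hve⟩
    · rcases he₂ e he with h' | ⟨v, hv, hve⟩
      · exact .inl (.inr h')
      · exact .inr ⟨v, .inr hv, hve⟩

theorem IDFamily.exists_isTriFamily {t : ℕ} {P : Fin t → SteinerPath G {x, y, z}}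
    (hP : IDFamily G {x, y, z} P) (hxy : x ≠ y) (hxz : x ≠ z) (hyz : y ≠ z) :
    ∃ F : Fin t → TriPath V, IsTriFamily G {x, y, z} F := by
  choose F hF hin hed using fun i => (P i).exists_triPath hxy hxz hyz
  refine ⟨F, hF, fun i j hij v hi hj => ?_, fun i j hij => Set.disjoint_left.2 fun e hi hj => ?_⟩
  · have : v ∈ ({x, y, z} : Set V) := (hP i j hij).1 ▸ ⟨hin i v hi, hin j v hj⟩
    exact (hF i).off v hi (by simpa using this)
  · exact (hP i j hij).2 e (hed i e hi) (hed j e hj)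

theorem IsTriFamily.exists_idFamily {t : ℕ} {F : Fin t → TriPath V} (h : IsTriFamily G S F) :
    ∃ P : Fin t → SteinerPath G (S : Set V), IDFamily G S P ∧
      ∀ i, ∀ v ∈ (P i).walk.support, v ∈ S ∨ v ∈ (F i).inner := by
  choose P hs he using fun i => (h.valid i).exists_steinerPath
  refine ⟨P, fun i j hij => ⟨?_, fun e hi hj => ?_⟩, hs⟩
  · ext v
    refine ⟨fun ⟨hi, hj⟩ => ?_, fun hv => ⟨(P i).contains v hv, (P j).contains v hv⟩⟩
    rcases hs i v hi with hv | hv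
    · exact hv
    · rcases hs j v hj with hv' | hv'
      · exact hv'
      · exact (h.disj i j hij hv hv').elim
  · have key : ∀ i j, i ≠ j → ∀ v ∈ (F i).inner, v ∈ e → e ∉ (P j).walk.edges := by
      intro i j hij v hv hve hmem
      rcases hs j v (Walk.mem_support_of_mem_edges hmem hve) with hv' | hv'
      · exact (h.valid i).off v hv hv'
      · exact h.disj i j hij hv hv'
    rcases he i e hi with hi' | ⟨v, hv, hve⟩
    · rcases he j e hj with hj' | ⟨v, hv, hve⟩
      · exact Set.disjoint_left.1 (h.edges i j hij) hi' hj'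
      · exact key j i hij.symm v hv hve hi
    · exact key i j hij v hv hve hj

theorem exists_idFamily_of_le_steinerPathNumber {V : Type*} {G : SimpleGraph V} {S : Set V}
    {t : ℕ} (ht : 0 < t) (hle : t ≤ steinerPathNumber G S) :
    ∃ P : Fin t → SteinerPath G S, IDFamily G S P := by
  have hb : BddAbove {t | ∃ P : Fin t → SteinerPath G S, IDFamily G S P} := by
    by_contra hb
    rw [steinerPathNumber, Nat.sSup_of_not_bddAbove hb] at hle
    omega
  have hne : {t | ∃ P : Fin t → SteinerPath G S, IDFamily G S P}.Nonempty := by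
    rw [Set.nonempty_iff_ne_empty]
    intro he
    rw [steinerPathNumber, he] at hle
    simp at hle
    omega
  obtain ⟨P, hP⟩ := Nat.sSup_mem hne hb
  exact ⟨fun i => P (Fin.castLE hle i), fun i j hij =>
    hP _ _ fun he => hij (Fin.castLE_injective hle he)⟩

end Conversion

/-- Lemma: if `3k - 4π₃(G) ≥ r + 3`, there is a maximum family of internally disjoint
`{x,y,z}`-paths avoiding two distinct neighbours `u, v` of `x`, `y` or `z`. -/
theorem stmt11 {V : Type*} (G : SimpleGraph V) (k : ℕ)
    (hreg : ∀ w, (G.neighborSet w).ncard = k) (hconn : G.Connected)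
    (hpi : 2 ≤ pathConnectivity G 3)
    (x y z : V) (hxy : x ≠ y) (hxz : x ≠ z) (hyz : y ≠ z)
    (r : ℕ)
    (hr : (G.neighborSet x ∩ G.neighborSet y ∩ G.neighborSet z).ncard = r)
    (hineq : 4 * pathConnectivity G 3 + r + 3 ≤ 3 * k) :
    ∃ (u v : V) (P : Fin (pathConnectivity G 3) → SteinerPath G {x, y, z}),
      u ≠ v ∧
      IDFamily G {x, y, z} P ∧
      u ∈ G.neighborSet x ∪ G.neighborSet y ∪ G.neighborSet z ∧
      v ∈ G.neighborSet x ∪ G.neighborSet y ∪ G.neighborSet z ∧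
      (∀ i, u ∉ (P i).walk.support) ∧ (∀ i, v ∉ (P i).walk.support) := by
  classical
  have hS : (({x, y, z} : Finset V) : Set V) = {x, y, z} := by simp
  have hS3 : ({x, y, z} : Finset V).card = 3 := Finset.card_eq_three.2 ⟨x, y, z, hxy, hxz, hyz, rfl⟩
  have hle : pathConnectivity G 3 ≤ steinerPathNumber G {x, y, z} :=
    Nat.sInf_le ⟨{x, y, z}, hS3, by rw [hS]⟩
  obtain ⟨P₀, hP₀⟩ := exists_idFamily_of_le_steinerPathNumber (by omega) hle
  obtain ⟨F₀, hF₀⟩ := hP₀.exists_isTriFamily hxy hxz hyz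
  obtain ⟨F, hF⟩ := IsMinTriFamily.exists_of_isTriFamily hF₀
  have hfin : ∀ w, (G.neighborSet w).Finite := fun w =>
    Set.finite_of_ncard_pos (by rw [hreg]; omega)
  have hij : (⟨0, by omega⟩ : Fin (pathConnectivity G 3)) ≠ ⟨1, by omega⟩ := by simp
  obtain ⟨u, v, huv, hw⟩ := hF.exists_unused_pair (k := k) (r := r) hij
    (nb := fun w => (hfin w).toFinset) (by simp)
    (fun w => by rw [← Set.ncard_eq_toFinset_card _ (hfin w), hreg])
    (fun R hR => by
      rw [← hr, ← Set.ncard_coe_finset]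
      refine Set.ncard_le_ncard (fun v hv => ?_) ((hfin x).subset fun v hv => hv.1.1)
      have := hR v hv
      simp at this
      exact ⟨⟨this.1, this.2.1⟩, this.2.2⟩)
    hS3 (by simpa using hineq)
  have hP : ∃ P : Fin (pathConnectivity G 3) → SteinerPath G {x, y, z}, IDFamily G {x, y, z} P ∧
      ∀ i, ∀ v ∈ (P i).walk.support, v ∈ ({x, y, z} : Finset V) ∨ v ∈ (F i).inner :=
    hS ▸ hF.1.exists_idFamily
  obtain ⟨P, hP, hsupp⟩ := hP
  have hN : ∀ w, w = u ∨ w = v →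
      w ∈ G.neighborSet x ∪ G.neighborSet y ∪ G.neighborSet z := by
    intro w h
    simpa [or_assoc] using (hw w h).2.1
  have hout : ∀ w, w = u ∨ w = v → ∀ i, w ∉ (P i).walk.support := fun w h i hmem =>
    (hsupp i w hmem).elim (hw w h).1 ((hw w h).2.2 i)
  exact ⟨u, v, P, huv, hP, hN u (.inl rfl), hN v (.inr rfl), hout u (.inl rfl), hout v (.inr rfl)⟩
end
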